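/- arXiv:1710.00761 — 10 statements merged into one kernel-verified Lean document; each statement's English description precedes it below -/
import Mathlib

section
/- Let M₀, M₁, …, M_{t-1} be the vertices, in cyclic order, of a cycle of the resonance graph R(G;F) (so t ≥ 3, the M_j are pairwise distinct perfect matchings of G, and M_j is adjacent to M_{j+1} in R(G;F) for every j, indices taken modulo t). For each j ∈ {0, …, t-1}, let i_j ∈ F be an index with M_j Δ M_{j+1} = E(i_j). Then every index i ∈ I occurs an even number of times in the sequence (i_0, i_1, …, i_{t-1}). -/
open SimpleGraph

variable {V : Type*} {I : Type*}

/-- `M` is (the edge set of) a perfect matching of the graph `G`: a set of edges of `G`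
such that every vertex of `G` is incident with exactly one edge of `M`. -/
def IsPM (G : SimpleGraph V) (M : Set (Sym2 V)) : Prop :=
  M ⊆ G.edgeSet ∧ ∀ v : V, ∃! e, e ∈ M ∧ v ∈ e

/-- `C` is the edge set of a connected 2-regular subgraph of `G`, i.e. a cycle of `G`. -/
def IsCycleSet (G : SimpleGraph V) (C : Set (Sym2 V)) : Prop :=
  C ⊆ G.edgeSet ∧ C.Nonempty ∧
    (∀ v ∈ (fromEdgeSet C).support, ((fromEdgeSet C).neighborSet v).ncard = 2) ∧
    ∀ v ∈ (fromEdgeSet C).support, ∀ w ∈ (fromEdgeSet C).support,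
      (fromEdgeSet C).Reachable v w

/-- `C` is an even cycle of `G`. -/
def IsEvenCycleSet (G : SimpleGraph V) (C : Set (Sym2 V)) : Prop :=
  IsCycleSet G C ∧ Even C.ncard

/-- The family `E : I → Set (Sym2 V)` is a face system on `G`: each `E i` is a set of
edges of `G`, every edge of `G` belongs to `E i` for exactly two indices `i`, and the
graph on `I` in which two distinct indices are adjacent iff their edge sets share an
edge is connected. -/
def IsFaceSystem (G : SimpleGraph V) (E : I → Set (Sym2 V)) : Prop :=
  (∀ i, E i ⊆ G.edgeSet) ∧
  (∀ e ∈ G.edgeSet, {i : I | e ∈ E i}.ncard = 2) ∧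
  (SimpleGraph.fromRel fun i j : I => (E i ∩ E j).Nonempty).Connected

/-- The resonance graph `R(G;F)`: its vertices are the perfect matchings of `G`, and two
perfect matchings are adjacent iff their symmetric difference is `E i` for some `i ∈ F`. -/
def resGraph (G : SimpleGraph V) (E : I → Set (Sym2 V)) (F : Set I) :
    SimpleGraph {M : Set (Sym2 V) // IsPM G M} :=
  SimpleGraph.fromRel fun M₁ M₂ => ∃ i ∈ F, symmDiff M₁.1 M₂.1 = E i

/-- If `M 0, M 1, …, M (t+2)` are the vertices, in cyclic order, of a
cycle of the resonance graph `R(G;F)` (a cycle has length at least 3, so we write the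
length as `t + 3`), and `idx j ∈ F` is an index with `(M j) Δ (M (j+1)) = E (idx j)`,
then every index `i ∈ I` occurs an even number of times among `idx 0, …, idx (t+2)`. -/
theorem statement0 [Fintype V] [Fintype I] (G : SimpleGraph V)
    (E : I → Set (Sym2 V)) (hface : IsFaceSystem G E)
    (F : Set I) (hF : F ≠ Set.univ) (hFcyc : ∀ i ∈ F, IsEvenCycleSet G (E i))
    (t : ℕ) (M : Fin (t + 3) → {M : Set (Sym2 V) // IsPM G M})
    (hMinj : Function.Injective M)
    (hadj : ∀ j : Fin (t + 3), (resGraph G E F).Adj (M j) (M (j + 1)))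
    (idx : Fin (t + 3) → I) (hidxF : ∀ j, idx j ∈ F)
    (hidx : ∀ j : Fin (t + 3), symmDiff (M j).1 (M (j + 1)).1 = E (idx j)) :
    ∀ i : I, Even {j : Fin (t + 3) | idx j = i}.ncard := by
  classical
  let c : I → ZMod 2 := fun i => ∑ j, if idx j = i then 1 else 0
  have hc : ∀ i, c i = (({j : Fin (t + 3) | idx j = i}.ncard : ℕ) : ZMod 2) := by
    intro i
    have h : {j : Fin (t + 3) | idx j = i} =
        ((Finset.univ.filter fun j => idx j = i : Finset (Fin (t + 3))) : Set (Fin (t + 3))) := by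
      ext j; simp
    rw [h, Set.ncard_coe_finset]
    simp [c, Finset.sum_boole]
  obtain ⟨hE, h2, hconn⟩ := hface
  have key : ∀ e : Sym2 V, ∑ i ∈ Finset.univ.filter (fun i => e ∈ E i), c i = 0 := by
    intro e
    let x : Fin (t + 3) → ZMod 2 := fun j => if e ∈ (M j).1 then 1 else 0
    have hx : ∀ j, (if e ∈ E (idx j) then (1 : ZMod 2) else 0) = x j + x (j + 1) := by
      intro j
      rw [← hidx j]
      by_cases h1 : e ∈ (M j).1 <;> by_cases h3 : e ∈ (M (j + 1)).1 <;>
        simp [x, Set.mem_symmDiff, h1, h3]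
      decide
    have hs : ∑ j, x (j + 1) = ∑ j, x j := Equiv.sum_comp (Equiv.addRight (1 : Fin (t + 3))) x
    calc ∑ i ∈ Finset.univ.filter (fun i => e ∈ E i), c i
        = ∑ j, (if e ∈ E (idx j) then (1 : ZMod 2) else 0) := by
          simp only [c]
          rw [Finset.sum_comm]
          refine Finset.sum_congr rfl fun j _ => ?_
          rw [Finset.sum_ite_eq]
          simp
      _ = 0 := by
          simp_rw [hx]
          rw [Finset.sum_add_distrib, hs]
          exact CharTwo.add_self_eq_zero _
  have hstep : ∀ i k, i ≠ k → (E i ∩ E k).Nonempty → c i = c k := by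
    rintro i k hik ⟨e, hei, hek⟩
    have hcard := h2 e (hE i hei)
    have hset : ({i, k} : Set I) = {i : I | e ∈ E i} := by
      apply Set.eq_of_subset_of_ncard_le
      · rintro a (rfl | rfl)
        · exact hei
        · exact hek
      · rw [hcard, Set.ncard_pair hik]
      · exact Set.toFinite _
    have hfs : Finset.univ.filter (fun i => e ∈ E i) = {i, k} := by
      ext a
      have := Set.ext_iff.1 hset a
      simpa using this.symm
    have h := key e
    rw [hfs, Finset.sum_pair hik] at h
    exact CharTwo.add_eq_zero.1 h
  obtain ⟨i0, hi0⟩ := (Set.ne_univ_iff_exists_notMem F).1 hF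
  have h0 : c i0 = 0 := by
    refine Finset.sum_eq_zero fun j _ => if_neg ?_
    rintro rfl
    exact hi0 (hidxF j)
  intro i
  have hci : c i = 0 := by
    obtain ⟨w⟩ := hconn.preconnected i i0
    induction w with
    | nil => exact h0
    | cons hadj' _ ih =>
      rw [SimpleGraph.fromRel_adj] at hadj'
      obtain ⟨hne, h | h⟩ := hadj'
      · rw [hstep _ _ hne h]; exact ih hi0 h0
      · rw [← hstep _ _ hne.symm h]; exact ih hi0 h0
  rw [hc] at hci
  exact (ZMod.natCast_eq_zero_iff_even).1 hci
end

section
/- The resonance graph R(G;F) is bipartite; equivalently, R(G;F) contains no cycle of odd length. -/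
open SimpleGraph

variable {V : Type*} {I : Type*}

/-- The resonance graph `R(G;F)` is bipartite (2-colorable,
equivalently it contains no odd cycle). -/
theorem statement1 [Fintype V] [Fintype I] (G : SimpleGraph V)
    (E : I → Set (Sym2 V)) (hface : IsFaceSystem G E)
    (F : Set I) (hF : F ≠ Set.univ) (hFcyc : ∀ i ∈ F, IsEvenCycleSet G (E i)) :
    (resGraph G E F).Colorable 2 := by
  classical
  obtain ⟨hsub, htwo, hconn⟩ := hface
  let v : I → (Sym2 V → ZMod 2) := fun i e => if e ∈ E i then 1 else 0
  have key : ∀ h : I → ZMod 2, (∀ i, i ∉ F → h i = 0) → ∑ i, h i • v i = 0 → ∀ i, h i = 0 := by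
    intro h h0 hs
    have hadj : ∀ i j, (SimpleGraph.fromRel fun i j : I => (E i ∩ E j).Nonempty).Adj i j →
        h i = h j := by
      intro i j hij
      rw [SimpleGraph.fromRel_adj] at hij
      obtain ⟨hne, hij⟩ := hij
      have : ∃ e, e ∈ E i ∧ e ∈ E j := by
        rcases hij with ⟨e, h1, h2⟩ | ⟨e, h1, h2⟩
        · exact ⟨e, h1, h2⟩
        · exact ⟨e, h2, h1⟩
      obtain ⟨e, hi, hj⟩ := this
      have hc := htwo e (hsub i hi)
      have hset : ({i, j} : Set I) = {i : I | e ∈ E i} := by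
        apply Set.eq_of_subset_of_ncard_le
        · rintro x (rfl | rfl)
          · exact hi
          · exact hj
        · rw [hc, Set.ncard_pair hne]
        · exact Set.toFinite _
      have hm : ∀ k, e ∈ E k ↔ k = i ∨ k = j := fun k => by
        have := Set.ext_iff.1 hset k
        simpa using this.symm
      have h3 := congrFun hs e
      simp only [Finset.sum_apply, Pi.smul_apply, smul_eq_mul, v, mul_ite, mul_one, mul_zero,
        Pi.zero_apply] at h3
      rw [← Finset.sum_filter] at h3
      have hf : (Finset.univ.filter fun k => e ∈ E k) = {i, j} := by
        ext k; simp [hm]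
      rw [hf, Finset.sum_pair hne] at h3
      exact CharTwo.add_eq_zero.1 h3
    obtain ⟨k, hk⟩ := (Set.ne_univ_iff_exists_notMem F).1 hF
    intro i
    obtain ⟨w⟩ := hconn.preconnected i k
    have : ∀ a b, (SimpleGraph.fromRel fun i j : I => (E i ∩ E j).Nonempty).Walk a b →
        h a = h b := by
      intro a b w
      induction w with
      | nil => rfl
      | cons hh _ ih => exact (hadj _ _ hh).trans ih
    rw [this i k w, h0 k hk]
  have hli : LinearIndependent (ZMod 2) (fun i : F => v i) := by
    rw [Fintype.linearIndependent_iff]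
    intro g hg i
    have := key (fun i => if hi : i ∈ F then g ⟨i, hi⟩ else 0) (fun i hi => by simp [hi]) ?_ i
    · simpa using this
    · rw [← hg, ← Finset.sum_subset (Finset.subset_univ F.toFinset)]
      · rw [Finset.sum_subtype (p := fun x => x ∈ F) F.toFinset (by simp)]
        exact Finset.sum_congr rfl (fun x _ => by simp)
      · intro x _ hx
        have : x ∉ F := by simpa using hx
        simp [this]
  obtain ⟨φ, hφ⟩ := LinearMap.exists_extend
    ((Module.Basis.span hli).constr (ZMod 2) (fun _ => (1 : ZMod 2)))
  have hφ1 : ∀ i ∈ F, φ (v i) = 1 := by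
    intro i hi
    have h1 := LinearMap.congr_fun hφ (Module.Basis.span hli ⟨i, hi⟩)
    rw [Module.Basis.constr_basis] at h1
    simpa [Module.Basis.span_apply] using h1
  let c : Set (Sym2 V) → (Sym2 V → ZMod 2) := fun M e => if e ∈ M then 1 else 0
  have hcol : ∀ M₁ M₂ : Set (Sym2 V), (∃ i ∈ F, symmDiff M₁ M₂ = E i) → φ (c M₁) ≠ φ (c M₂) := by
    rintro M₁ M₂ ⟨i, hi, hE⟩ heq
    have hv : v i = c M₁ + c M₂ := by
      ext e
      simp only [v, c, ← hE, Set.mem_symmDiff, Pi.add_apply]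
      by_cases h1 : e ∈ M₁ <;> by_cases h2 : e ∈ M₂ <;> simp [h1, h2]
      decide
    have := hφ1 i hi
    rw [hv, map_add, heq, CharTwo.add_self_eq_zero] at this
    exact zero_ne_one this
  have hC : (resGraph G E F).Coloring (ZMod 2) := SimpleGraph.Coloring.mk (fun M => φ (c M.1)) (by
    intro M₁ M₂ hadj
    simp only [resGraph, SimpleGraph.fromRel_adj] at hadj
    rcases hadj.2 with h | h
    · exact hcol _ _ h
    · exact (hcol _ _ h).symm)
  simpa using hC.colorable
end

section
/- Let i ∈ F and let {M₁, M₂} be an edge of the resonance graph R(G;F) with M₁ Δ M₂ = E(i). Then M₁ and M₂ lie in different connected components of the graph obtained from R(G;F) by deleting all edges in E_i. -/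
open SimpleGraph

variable {V : Type*} {I : Type*}

/-- The graph obtained from the resonance graph `R(G;F)` by deleting all edges of
`E_i`, i.e. all edges `{M₁, M₂}` with `M₁ Δ M₂ = E i`. -/
def resGraphDel (G : SimpleGraph V) (E : I → Set (Sym2 V)) (F : Set I) (i : I) :
    SimpleGraph {M : Set (Sym2 V) // IsPM G M} :=
  SimpleGraph.fromRel fun M₁ M₂ =>
    (∃ j ∈ F, symmDiff M₁.1 M₂.1 = E j) ∧ symmDiff M₁.1 M₂.1 ≠ E i

open Classical in
lemma walk_inv [Fintype I] (G : SimpleGraph V) (E : I → Set (Sym2 V)) (F : Set I) (i : I)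
    (M N : {M : Set (Sym2 V) // IsPM G M}) (h : (resGraphDel G E F i).Reachable M N) :
    ∃ c : I → ZMod 2, c i = 0 ∧ (∀ j, j ∉ F → c j = 0) ∧
      ∀ e, (if e ∈ symmDiff M.1 N.1 then (1 : ZMod 2) else 0) =
        ∑ j, c j * (if e ∈ E j then 1 else 0) := by
  obtain ⟨w⟩ := h
  induction w with
  | nil => exact ⟨0, rfl, fun _ _ => rfl, by simp⟩
  | @cons u v w hadj p ih =>
    obtain ⟨c, hci, hcF, hc⟩ := ih
    have key : (∃ j ∈ F, symmDiff u.1 v.1 = E j) ∧ symmDiff u.1 v.1 ≠ E i := by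
      rcases hadj.2 with h | h
      · exact h
      · rwa [symmDiff_comm] at h
    obtain ⟨⟨j, hj, hE⟩, hne⟩ := key
    have hji : i ≠ j := by
      rintro rfl
      exact hne hE
    refine ⟨c + Pi.single j 1, ?_, ?_, ?_⟩
    · simp [hci, hji]
    · intro k hk
      have : k ≠ j := by
        rintro rfl
        exact hk hj
      simp [hcF k hk, this]
    · intro e
      have h2 : ∑ k, (c + Pi.single j 1 : I → ZMod 2) k * (if e ∈ E k then (1 : ZMod 2) else 0) =
          ∑ k, c k * (if e ∈ E k then 1 else 0) + (if e ∈ E j then 1 else 0) := by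
        simp only [Pi.add_apply, add_mul, Finset.sum_add_distrib]
        congr 1
        rw [Finset.sum_eq_single j]
        · simp
        · intro b _ hb
          simp [hb]
        · simp
      rw [h2, ← hc e, ← hE]
      have h11 : (1 : ZMod 2) + 1 = 0 := by decide
      by_cases a : e ∈ u.1 <;> by_cases b : e ∈ v.1 <;> by_cases d : e ∈ w.1 <;>
        simp [Set.mem_symmDiff, a, b, d, h11]

/-- If `{M₁, M₂}` is an edge of `R(G;F)` with `M₁ Δ M₂ = E i` for
some `i ∈ F`, then `M₁` and `M₂` lie in different connected components of the graph
obtained from `R(G;F)` by deleting all edges in `E_i`. -/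
theorem statement2 [Fintype V] [Fintype I] (G : SimpleGraph V)
    (E : I → Set (Sym2 V)) (hface : IsFaceSystem G E)
    (F : Set I) (hF : F ≠ Set.univ) (hFcyc : ∀ i ∈ F, IsEvenCycleSet G (E i))
    (i : I) (hi : i ∈ F) (M₁ M₂ : {M : Set (Sym2 V) // IsPM G M})
    (hadj : (resGraph G E F).Adj M₁ M₂) (hsd : symmDiff M₁.1 M₂.1 = E i) :
    ¬ (resGraphDel G E F i).Reachable M₁ M₂ := by
  classical
  intro hr
  obtain ⟨c, hci, hcF, hc⟩ := walk_inv G E F i M₁ M₂ hr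
  have hstep : ∀ a b, a ≠ b → (E a ∩ E b).Nonempty →
      (c + Pi.single i 1 : I → ZMod 2) a = (c + Pi.single i 1 : I → ZMod 2) b := by
    rintro a b hab ⟨e, hea, heb⟩
    have hcard := hface.2.1 e (hface.1 a hea)
    have hset : ({a, b} : Set I) = {k | e ∈ E k} := by
      apply Set.eq_of_subset_of_ncard_le
      · rintro k (rfl | rfl)
        · exact hea
        · exact heb
      · rw [hcard, Set.ncard_pair hab]
      · exact Set.toFinite _
    have h0 := hc e
    rw [hsd] at h0
    have h1 : ∑ j, c j * (if e ∈ E j then (1 : ZMod 2) else 0) = c a + c b := by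
      have : ∀ j, (e ∈ E j ↔ j ∈ ({a, b} : Finset I)) := by
        intro j
        have := Set.ext_iff.1 hset j
        simpa using this.symm
      simp only [this, mul_ite, mul_one, mul_zero]
      rw [Finset.sum_ite_mem, Finset.univ_inter, Finset.sum_pair hab]
    rw [h1] at h0
    have hi' : e ∈ E i ↔ i = a ∨ i = b := by
      have := Set.ext_iff.1 hset i
      simpa using this.symm
    have e2 : ∀ x y : ZMod 2, 0 = x + y → x = y := by decide
    have e3 : ∀ x y : ZMod 2, 1 = x + y → x + 1 = y := by decide
    have e4 : ∀ x y : ZMod 2, 1 = x + y → x = y + 1 := by decide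
    by_cases ha : i = a
    · subst ha
      simp only [hi', true_or, if_true] at h0
      simpa [Pi.single_apply, hab.symm] using e3 _ _ h0
    · by_cases hb : i = b
      · subst hb
        simp only [hi', or_true, if_true] at h0
        simpa [Pi.single_apply, hab] using e4 _ _ h0
      · simp only [hi', ha, hb, or_self, if_false] at h0
        simpa [Pi.single_apply, Ne.symm ha, Ne.symm hb] using e2 _ _ h0
  obtain ⟨k, hk⟩ := (Set.ne_univ_iff_exists_notMem F).1 hF
  have hconst : ∀ a b, (SimpleGraph.fromRel fun i j : I => (E i ∩ E j).Nonempty).Reachable a b →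
      (c + Pi.single i 1 : I → ZMod 2) a = (c + Pi.single i 1 : I → ZMod 2) b := by
    rintro a b ⟨w⟩
    induction w with
    | nil => rfl
    | cons h p ih =>
      rw [← ih]
      apply hstep _ _ h.1
      rcases h.2 with h | h
      · exact h
      · rwa [Set.inter_comm] at h
  have hki : k ≠ i := by
    rintro rfl
    exact hk hi
  have := hconst i k (hface.2.2.preconnected i k)
  simp [hci, hcF k hk, hki] at this
end

section
/- Let i ∈ F. Then every cycle of the resonance graph R(G;F) contains an even number of edges of E_i; consequently, the quotient graph whose vertices are the connected components of the graph obtained from R(G;F) by deleting all edges of E_i, two components being adjacent if and only if some edge of E_i has one endpoint in each of them, is bipartite. -/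
open SimpleGraph

variable {V : Type*} {I : Type*}

/-- The quotient graph whose vertices are the connected components of
`R(G;F) \ E_i`, two components being adjacent iff some edge of `E_i` has one endpoint
in each of them. -/
def quotGraph (G : SimpleGraph V) (E : I → Set (Sym2 V)) (F : Set I) (i : I) :
    SimpleGraph (resGraphDel G E F i).ConnectedComponent :=
  SimpleGraph.fromRel fun c d =>
    ∃ M₁ M₂ : {M : Set (Sym2 V) // IsPM G M},
      (resGraph G E F).Adj M₁ M₂ ∧ symmDiff M₁.1 M₂.1 = E i ∧
      (resGraphDel G E F i).connectedComponentMk M₁ = c ∧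
      (resGraphDel G E F i).connectedComponentMk M₂ = d

noncomputable def indv (A : Set (Sym2 V)) : Sym2 V → ZMod 2 := A.indicator 1

theorem indv_symmDiff (A B : Set (Sym2 V)) : indv (symmDiff A B) = indv A + indv B := by
  classical
  funext e
  by_cases ha : e ∈ A <;> by_cases hb : e ∈ B <;>
    simp [indv, Set.indicator, Set.mem_symmDiff, ha, hb] <;> decide

theorem const_of_rel [Fintype I] (G : SimpleGraph V)
    (E : I → Set (Sym2 V)) (hface : IsFaceSystem G E) (h : I → ZMod 2)
    (hs : ∀ e, ∑ k, h k * indv (E k) e = 0) (a b : I) : h a = h b := by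
  classical
  have adj : ∀ a b : I, a ≠ b → (E a ∩ E b).Nonempty → h a = h b := by
    rintro a b hab ⟨e, hea, heb⟩
    have h2 := hface.2.1 e (hface.1 a hea)
    have hset : ({a, b} : Set I) = {i : I | e ∈ E i} := by
      apply Set.eq_of_subset_of_ncard_le
      · rintro x (rfl | rfl) <;> assumption
      · rw [h2, Set.ncard_pair hab]
      · exact Set.toFinite _
    have hsum := hs e
    have : ∑ k, h k * indv (E k) e = ∑ k ∈ ({a, b} : Finset I), h k := by
      rw [← Finset.sum_subset (Finset.subset_univ ({a, b} : Finset I))]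
      · refine Finset.sum_congr rfl fun x hx => ?_
        have hx' : e ∈ E x := by
          have : x ∈ ({a, b} : Set I) := by simpa using hx
          rw [hset] at this; exact this
        simp [indv, hx']
      · intro x _ hx
        have hx' : e ∉ E x := by
          intro hc
          have : x ∈ ({a, b} : Set I) := by rw [hset]; exact hc
          exact hx (by simpa using this)
        simp [indv, hx']
    rw [this, Finset.sum_pair hab] at hsum
    exact CharTwo.add_eq_zero.mp hsum
  obtain ⟨w⟩ := hface.2.2.preconnected a b
  induction w with
  | nil => rfl
  | cons hadj _ ih =>
    rw [← ih]
    rw [SimpleGraph.fromRel_adj] at hadj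
    rcases hadj with ⟨hne, h1 | h1⟩
    · exact adj _ _ hne h1
    · exact (adj _ _ hne.symm h1).symm

theorem exists_functional [Fintype I] (G : SimpleGraph V)
    (E : I → Set (Sym2 V)) (hface : IsFaceSystem G E)
    (F : Set I) (hF : F ≠ Set.univ) (i : I) (hi : i ∈ F) :
    ∃ φ : (Sym2 V → ZMod 2) →ₗ[ZMod 2] ZMod 2,
      φ (indv (E i)) = 1 ∧ ∀ j ∈ F, j ≠ i → φ (indv (E j)) = 0 := by
  classical
  have hli : LinearIndependent (ZMod 2) (fun j : F => indv (E j)) := by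
    rw [Fintype.linearIndependent_iff]
    intro g hg j
    obtain ⟨k, hk⟩ := (Set.ne_univ_iff_exists_notMem F).mp hF
    let h : I → ZMod 2 := fun x => if hx : x ∈ F then g ⟨x, hx⟩ else 0
    have hc := const_of_rel G E hface h (by
      intro e
      have h1 := congrFun hg e
      simp only [Finset.sum_apply, Pi.smul_apply, smul_eq_mul, Pi.zero_apply] at h1
      rw [← h1]
      have h2 : ∑ k ∈ Finset.univ.filter (· ∈ F), h k * indv (E k) e
          = ∑ k, h k * indv (E k) e := by
        apply Finset.sum_subset (Finset.subset_univ _)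
        intro x _ hx
        have : x ∉ F := by simpa using hx
        simp [h, this]
      rw [← h2, Finset.sum_subtype (p := (· ∈ F)) _ (by simp)]
      refine Finset.sum_congr rfl fun x _ => ?_
      simp [h]) j k
    simpa [h, hk] using hc
  obtain ⟨f, hf⟩ := LinearMap.exists_leftInverse_of_injective
    (Finsupp.linearCombination (ZMod 2) (fun j : F => indv (E j)))
    (LinearMap.ker_eq_bot.mpr hli)
  have key : ∀ j : F, f (indv (E j)) = Finsupp.single j 1 := by
    intro j
    have := LinearMap.congr_fun hf (Finsupp.single j 1)
    simpa using this
  refine ⟨(Finsupp.lapply ⟨i, hi⟩).comp f, ?_, ?_⟩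
  · simp [key ⟨i, hi⟩]
  · intro j hj hne
    have := key ⟨j, hj⟩
    simp only [] at this
    simp [this, Finsupp.single_apply, hne]

/-- For `i ∈ F`, every cycle of `R(G;F)` (written with cyclic vertex
sequence `M 0, …, M (t+2)`) contains an even number of edges of `E_i`; consequently the
quotient graph of the connected components of `R(G;F) \ E_i` is bipartite. -/
theorem statement3 [Fintype V] [Fintype I] (G : SimpleGraph V)
    (E : I → Set (Sym2 V)) (hface : IsFaceSystem G E)
    (F : Set I) (hF : F ≠ Set.univ) (hFcyc : ∀ i ∈ F, IsEvenCycleSet G (E i))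
    (i : I) (hi : i ∈ F) :
    (∀ (t : ℕ) (M : Fin (t + 3) → {M : Set (Sym2 V) // IsPM G M}),
        Function.Injective M →
        (∀ j : Fin (t + 3), (resGraph G E F).Adj (M j) (M (j + 1))) →
        Even {j : Fin (t + 3) | symmDiff (M j).1 (M (j + 1)).1 = E i}.ncard) ∧
      (quotGraph G E F i).Colorable 2 := by
  classical
  obtain ⟨φ, h1, h0⟩ := exists_functional G E hface F hF i hi
  have step : ∀ M₁ M₂ : {M : Set (Sym2 V) // IsPM G M}, (resGraph G E F).Adj M₁ M₂ →
      φ (indv M₁.1) + φ (indv M₂.1) = if symmDiff M₁.1 M₂.1 = E i then 1 else 0 := by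
    intro M₁ M₂ h
    rw [← map_add, ← indv_symmDiff]
    split_ifs with hc
    · rw [hc, h1]
    · rw [resGraph, SimpleGraph.fromRel_adj] at h
      rcases h with ⟨_, ⟨j, hj, he⟩ | ⟨j, hj, he⟩⟩
      · rw [he]; exact h0 j hj (by rintro rfl; exact hc he)
      · rw [symmDiff_comm] at he
        rw [he]; exact h0 j hj (by rintro rfl; exact hc he)
  constructor
  · intro t M _ hadj
    have hsum : ∑ j, (φ (indv (M j).1) + φ (indv (M (j + 1)).1)) = 0 := by
      have hp : ∑ j, φ (indv (M (j + 1)).1) = ∑ j, φ (indv (M j).1) :=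
        Equiv.sum_comp (Equiv.addRight (1 : Fin (t + 3))) (fun j => φ (indv (M j).1))
      rw [Finset.sum_add_distrib, hp]
      exact CharTwo.add_self_eq_zero _
    rw [Finset.sum_congr rfl fun j _ => step _ _ (hadj j), Finset.sum_boole] at hsum
    rw [← ZMod.natCast_eq_zero_iff_even, ← hsum, Set.ncard_eq_toFinset_card']
    congr 2
    ext; simp
  · have hdel : ∀ M₁ M₂, (resGraphDel G E F i).Adj M₁ M₂ →
        φ (indv M₁.1) = φ (indv M₂.1) := by
      intro M₁ M₂ h
      rw [resGraphDel, SimpleGraph.fromRel_adj] at h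
      have hadj : (resGraph G E F).Adj M₁ M₂ := by
        rw [resGraph, SimpleGraph.fromRel_adj]
        exact ⟨h.1, h.2.imp And.left And.left⟩
      have hne : symmDiff M₁.1 M₂.1 ≠ E i := by
        rcases h.2 with h | h
        · exact h.2
        · rw [symmDiff_comm]; exact h.2
      have := step _ _ hadj
      rw [if_neg hne] at this
      exact CharTwo.add_eq_zero.mp this
    let c : (resGraphDel G E F i).ConnectedComponent → ZMod 2 :=
      fun C => C.lift (fun M => φ (indv M.1)) (by
        intro v w p _
        induction p with
        | nil => rfl
        | cons h _ ih => exact (hdel _ _ h).trans (ih (by simp_all)))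
    have hc : ∀ x y, (∃ M₁ M₂ : {M : Set (Sym2 V) // IsPM G M},
      (resGraph G E F).Adj M₁ M₂ ∧ symmDiff M₁.1 M₂.1 = E i ∧
      (resGraphDel G E F i).connectedComponentMk M₁ = x ∧
      (resGraphDel G E F i).connectedComponentMk M₂ = y) → c x ≠ c y := by
      rintro x y ⟨M₁, M₂, hadj, he, rfl, rfl⟩ heq
      have := step _ _ hadj
      rw [if_pos he] at this
      have heq' : φ (indv M₁.1) = φ (indv M₂.1) := heq
      rw [heq', CharTwo.add_self_eq_zero] at this
      exact zero_ne_one this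
    refine ⟨SimpleGraph.Coloring.mk (fun C => (c C : Fin 2)) ?_⟩
    intro x y h
    rw [quotGraph, SimpleGraph.fromRel_adj] at h
    rcases h.2 with h | h
    · exact hc _ _ h
    · exact (hc _ _ h).symm
end

section
/- Let H be a connected component of the resonance graph R(G;F), and let k be the number of indices i ∈ F for which there exist adjacent vertices M₁, M₂ of H with M₁ Δ M₂ = E(i). Then there exists an injective map ℓ from the vertex set of H to {0,1}^k such that two vertices M₁, M₂ of H are adjacent in R(G;F) if and only if ℓ(M₁) and ℓ(M₂) differ in exactly one coordinate; that is, H embeds into the k-dimensional hypercube Q_k as an induced subgraph. -/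
open SimpleGraph

variable {V : Type*} {I : Type*}

open Classical in
/-- indicator mod 2 -/
noncomputable def ind2 {V : Type*} (A : Set (Sym2 V)) (e : Sym2 V) : ZMod 2 :=
  if e ∈ A then 1 else 0

theorem ind2_symmDiff {V : Type*} (A B : Set (Sym2 V)) (e : Sym2 V) :
    ind2 (symmDiff A B) e = ind2 A e + ind2 B e := by
  unfold ind2
  by_cases h1 : e ∈ A <;> by_cases h2 : e ∈ B <;> simp [Set.mem_symmDiff, h1, h2]
  decide

theorem ind2_inj {V : Type*} {A B : Set (Sym2 V)} (h : ∀ e, ind2 A e = ind2 B e) : A = B := by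
  ext e
  have := h e
  unfold ind2 at this
  by_cases h1 : e ∈ A <;> by_cases h2 : e ∈ B <;> simp_all

theorem zmod2_cases (a : ZMod 2) : a = 0 ∨ a = 1 := by
  revert a; decide

theorem zmod2_add_eq_zero (a b : ZMod 2) : a + b = 0 ↔ a = b := by
  revert a b; decide

theorem indep_faces {V I : Type*} [Fintype I] (G : SimpleGraph V)
    (E : I → Set (Sym2 V)) (hface : IsFaceSystem G E)
    (F : Set I) (hF : F ≠ Set.univ) (x : I → ZMod 2) (hx : ∀ i, i ∉ F → x i = 0)
    (h : ∀ e, ∑ i, x i * ind2 (E i) e = 0) : x = 0 := by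
  classical
  obtain ⟨h1, h2, h3⟩ := hface
  have key : ∀ i j, (SimpleGraph.fromRel fun i j : I => (E i ∩ E j).Nonempty).Adj i j →
      x i = x j := by
    intro i j hij
    rw [SimpleGraph.fromRel_adj] at hij
    obtain ⟨hne, hij⟩ := hij
    have : ∃ e, e ∈ E i ∧ e ∈ E j := by
      rcases hij with ⟨e, he⟩ | ⟨e, he⟩
      · exact ⟨e, he.1, he.2⟩
      · exact ⟨e, he.2, he.1⟩
    obtain ⟨e, hi, hj⟩ := this
    have hc := h2 e (h1 i hi)
    have hs : ({i, j} : Set I) = {i : I | e ∈ E i} := by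
      apply Set.eq_of_subset_of_ncard_le
      · rintro a (rfl | rfl)
        · exact hi
        · exact hj
      · rw [hc, Set.ncard_pair hne]
      · exact Set.toFinite _
    have hmem : ∀ a, e ∈ E a ↔ a = i ∨ a = j := by
      intro a
      have := Set.ext_iff.1 hs a
      simpa using this.symm
    have he := h e
    rw [← Finset.sum_subset (Finset.subset_univ {i, j}), Finset.sum_pair hne] at he
    · simp only [ind2, hi, hj, if_true, mul_one] at he
      exact (zmod2_add_eq_zero _ _).1 he
    · intro a _ ha
      have : e ∉ E a := by
        rw [hmem]; simpa using ha
      simp [ind2, this]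
  obtain ⟨i0, hi0⟩ := (Set.ne_univ_iff_exists_notMem F).1 hF
  funext i
  have hr := h3.preconnected i i0
  rw [SimpleGraph.reachable_iff_reflTransGen] at hr
  have : x i = x i0 := by
    clear hi0
    induction hr with
    | refl => rfl
    | tail _ hab ih => rw [ih]; exact key _ _ hab
  rw [this, hx i0 hi0]; rfl

/-- Let `H` be a connected component of `R(G;F)` and let `k` be the
number of indices `i ∈ F` for which some edge of `H` has symmetric difference `E i`.
Then there is an injective map `ℓ` from the vertex set of `H` to `{0,1}^k` such that two
vertices of `H` are adjacent in `R(G;F)` iff their images differ in exactly one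
coordinate; i.e. `H` embeds into the hypercube `Q_k` as an induced subgraph. -/
theorem statement4 [Fintype V] [Fintype I] (G : SimpleGraph V)
    (E : I → Set (Sym2 V)) (hface : IsFaceSystem G E)
    (F : Set I) (hF : F ≠ Set.univ) (hFcyc : ∀ i ∈ F, IsEvenCycleSet G (E i))
    (H : (resGraph G E F).ConnectedComponent) (k : ℕ)
    (hk : k = {i ∈ F | ∃ M₁ M₂ : {M : Set (Sym2 V) // IsPM G M},
        (resGraph G E F).connectedComponentMk M₁ = H ∧
        (resGraph G E F).connectedComponentMk M₂ = H ∧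
        (resGraph G E F).Adj M₁ M₂ ∧ symmDiff M₁.1 M₂.1 = E i}.ncard) :
    ∃ ℓ : {M : {M : Set (Sym2 V) // IsPM G M} //
            (resGraph G E F).connectedComponentMk M = H} → (Fin k → Bool),
      Function.Injective ℓ ∧
      ∀ M₁ M₂, ((resGraph G E F).Adj M₁.1 M₂.1 ↔ ∃! j : Fin k, ℓ M₁ j ≠ ℓ M₂ j) := by
  classical
  set K : Set I := {i ∈ F | ∃ M₁ M₂ : {M : Set (Sym2 V) // IsPM G M},
        (resGraph G E F).connectedComponentMk M₁ = H ∧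
        (resGraph G E F).connectedComponentMk M₂ = H ∧
        (resGraph G E F).Adj M₁ M₂ ∧ symmDiff M₁.1 M₂.1 = E i} with hK
  have adjE : ∀ M₁ M₂, (resGraph G E F).Adj M₁ M₂ → ∃ i ∈ F, symmDiff M₁.1 M₂.1 = E i := by
    intro M₁ M₂ h
    rw [resGraph, SimpleGraph.fromRel_adj] at h
    rcases h.2 with h | ⟨i, hi, h⟩
    · exact h
    · exact ⟨i, hi, by rw [symmDiff_comm]; exact h⟩
  obtain ⟨M0, hM0⟩ := H.exists_rep
  have hM0 : (resGraph G E F).connectedComponentMk M0 = H := hM0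
  have ex : ∀ M : {M : {M : Set (Sym2 V) // IsPM G M} //
            (resGraph G E F).connectedComponentMk M = H},
      ∃ x : I → ZMod 2, (∀ i, i ∉ K → x i = 0) ∧
        ∀ e, ind2 M.1.1 e = ind2 M0.1 e + ∑ i, x i * ind2 (E i) e := by
    rintro ⟨M, hM⟩
    have hr : (resGraph G E F).Reachable M0 M := by
      rw [← SimpleGraph.ConnectedComponent.eq, hM0, hM]
    rw [SimpleGraph.reachable_iff_reflTransGen] at hr
    induction hr with
    | refl => exact ⟨0, fun _ _ => rfl, fun e => by simp⟩
    | @tail B C _ hab ih =>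
      have hB : (resGraph G E F).connectedComponentMk B = H := by
        rw [← hM, SimpleGraph.ConnectedComponent.eq]; exact hab.reachable
      obtain ⟨x, hx, hxe⟩ := ih hB
      obtain ⟨i, hi, hE⟩ := adjE _ _ hab
      have hiK : i ∈ K := ⟨hi, B, C, hB, hM, hab, hE⟩
      refine ⟨x + Pi.single i 1, ?_, ?_⟩
      · intro a ha
        have : a ≠ i := fun h => ha (h ▸ hiK)
        simp [hx a ha, this]
      · intro e
        have h1 := ind2_symmDiff B.1 C.1 e
        rw [hE] at h1
        have h2 := hxe e
        simp only [Pi.add_apply, add_mul, Finset.sum_add_distrib, Pi.single_apply, ite_mul,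
          one_mul, zero_mul, Finset.sum_ite_eq', Finset.mem_univ, if_true]
        rw [← add_assoc, ← h2, h1, ← add_assoc, CharTwo.add_self_eq_zero, zero_add]
  choose x hxK hxe using ex
  have diff : ∀ M₁ M₂ e, ind2 (symmDiff M₁.1.1 M₂.1.1) e
      = ∑ i, (x M₁ i + x M₂ i) * ind2 (E i) e := by
    intro M₁ M₂ e
    rw [ind2_symmDiff, hxe M₁, hxe M₂]
    simp only [add_mul, Finset.sum_add_distrib]
    have := CharTwo.add_self_eq_zero (ind2 M0.1 e)
    linear_combination this
  have hcard : Nat.card K = k := by rw [hk]; rfl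
  let φ : Fin k ≃ K := (Finite.equivFinOfCardEq hcard).symm
  have hne : ∀ a b : ZMod 2, decide (a = 1) ≠ decide (b = 1) ↔ a + b = 1 := by decide
  have hl : ∀ M₁ M₂ (j : Fin k),
      decide (x M₁ (φ j) = 1) ≠ decide (x M₂ (φ j) = 1) ↔ x M₁ (φ j) + x M₂ (φ j) = 1 :=
    fun _ _ _ => hne _ _
  refine ⟨fun M j => decide (x M (φ j) = 1), ?_, ?_⟩
  · intro M₁ M₂ h
    have hx : ∀ i, x M₁ i = x M₂ i := by
      intro i
      by_cases hi : i ∈ K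
      · have h1 := congrFun h (φ.symm ⟨i, hi⟩)
        have h2 := (not_congr (hl M₁ M₂ (φ.symm ⟨i, hi⟩))).1 (not_not.2 h1)
        simp only [Equiv.apply_symm_apply] at h2
        exact (zmod2_add_eq_zero _ _).1 ((zmod2_cases _).resolve_right h2)
      · rw [hxK _ i hi, hxK _ i hi]
    apply Subtype.ext
    apply Subtype.ext
    apply ind2_inj
    intro e
    rw [hxe M₁, hxe M₂]
    simp only [hx]
  · intro M₁ M₂
    simp only [hl]
    constructor
    · intro h
      obtain ⟨i, hi, hE⟩ := adjE _ _ h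
      have hiK : i ∈ K := ⟨hi, M₁.1, M₂.1, M₁.2, M₂.2, h, hE⟩
      have h0 : (fun a => x M₁ a + x M₂ a + Pi.single (M := fun _ => ZMod 2) i 1 a) = 0 := by
        apply indep_faces G E hface F hF
        · intro a ha
          have haK : a ∉ K := fun h => ha h.1
          have : a ≠ i := fun h => ha (h ▸ hi)
          simp [hxK _ a haK, this]
        · intro e
          have h1 := diff M₁ M₂ e
          rw [hE] at h1
          have h2 : ∑ a, Pi.single (M := fun _ => ZMod 2) i 1 a * ind2 (E a) e = ind2 (E i) e := by
            simp [Pi.single_apply]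
          simp_rw [add_mul (x M₁ _ + x M₂ _)]
          rw [Finset.sum_add_distrib, h2]
          rw [← h1, CharTwo.add_self_eq_zero]
      have h1 : ∀ a, x M₁ a + x M₂ a = Pi.single (M := fun _ => ZMod 2) i 1 a :=
        fun a => (zmod2_add_eq_zero _ _).1 (congrFun h0 a)
      refine ⟨φ.symm ⟨i, hiK⟩, ?_, ?_⟩
      · simp [h1]
      · intro j hj
        simp only [h1, Pi.single_apply] at hj
        have : (φ j : I) = i := by
          by_contra hc
          simp [hc] at hj
        rw [Equiv.eq_symm_apply]
        exact Subtype.ext this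
    · rintro ⟨j, hj, hu⟩
      have hs : ∀ a, x M₁ a + x M₂ a = if a = (φ j : I) then 1 else 0 := by
        intro a
        split_ifs with ha
        · rw [ha]; exact hj
        · by_cases haK : a ∈ K
          · refine (zmod2_cases _).resolve_right fun h => ha ?_
            have := hu (φ.symm ⟨a, haK⟩) (by simpa using h)
            rw [← this]; simp
          · simp [hxK _ a haK]
      have hE : symmDiff M₁.1.1 M₂.1.1 = E (φ j) := by
        apply ind2_inj
        intro e
        rw [diff]
        simp [hs]
      refine (SimpleGraph.fromRel_adj _ _ _).2 ⟨?_, Or.inl ⟨φ j, (φ j).2.1, hE⟩⟩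
      intro h
      have : M₁ = M₂ := Subtype.ext h
      subst this
      simp only [CharTwo.add_self_eq_zero] at hj
      exact zero_ne_one hj
end

section
/- Every connected component of the resonance graph R(G;F) is an induced cubical graph: for each connected component H of R(G;F) there exist a natural number n and an injective map from the vertex set of H into {0,1}^n under which two vertices of H are adjacent in R(G;F) if and only if their images differ in exactly one coordinate. -/
open SimpleGraph

variable {V : Type*} {I : Type*}

open Classical in
/-- indicator vector mod 2 -/
noncomputable def chi (M : Set (Sym2 V)) (e : Sym2 V) : ZMod 2 := if e ∈ M then 1 else 0

/-- sum of the face vectors -/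
noncomputable def phi [Fintype I] (E : I → Set (Sym2 V)) (x : I → ZMod 2) (e : Sym2 V) : ZMod 2 :=
  ∑ i, x i * chi (E i) e

theorem chi_inj {M N : Set (Sym2 V)} (h : chi M = chi N) : M = N := by
  ext e
  have := congrFun h e
  unfold chi at this
  by_cases h1 : e ∈ M <;> by_cases h2 : e ∈ N <;> simp_all

theorem chi_symmDiff (M N : Set (Sym2 V)) : chi (symmDiff M N) = chi M + chi N := by
  ext e
  have h11 : (1 : ZMod 2) + 1 = 0 := by decide
  by_cases h1 : e ∈ M <;> by_cases h2 : e ∈ N <;>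
    simp [chi, Set.mem_symmDiff, h1, h2, h11]

theorem phi_add [Fintype I] (E : I → Set (Sym2 V)) (x y : I → ZMod 2) :
    phi E (x + y) = phi E x + phi E y := by
  ext e
  simp [phi, add_mul, Finset.sum_add_distrib]

open Classical in
theorem phi_single [Fintype I] (E : I → Set (Sym2 V)) (i : I) :
    phi E (Pi.single i 1) = chi (E i) := by
  ext e
  unfold phi
  rw [Finset.sum_eq_single i]
  · simp
  · intro b _ hb
    simp [hb]
  · simp

theorem z2_self (a : ZMod 2) : a + a = 0 := by revert a; decide

theorem z2_eq (a b : ZMod 2) (h : a + b = 0) : a = b := by revert a b; decide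

theorem phi_ker [Fintype I] {G : SimpleGraph V} {E : I → Set (Sym2 V)}
    (hface : IsFaceSystem G E) {F : Set I} (hF : F ≠ Set.univ) (x : I → ZMod 2)
    (hx : ∀ i, i ∉ F → x i = 0) (h0 : phi E x = 0) : x = 0 := by
  classical
  obtain ⟨hsub, htwo, hconn⟩ := hface
  have key : ∀ i j, i ≠ j → (E i ∩ E j).Nonempty → x i = x j := by
    rintro i j hij ⟨e, hei, hej⟩
    have h2 := htwo e (hsub i hei)
    have hset : ({i, j} : Set I) = {k | e ∈ E k} := by
      apply Set.eq_of_subset_of_ncard_le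
      · rintro k (rfl | rfl)
        · exact hei
        · exact hej
      · rw [h2, Set.ncard_pair hij]
      · exact Set.toFinite _
    have hs : phi E x e = x i + x j := by
      unfold phi
      rw [← Finset.sum_subset (Finset.subset_univ {i, j}), Finset.sum_pair hij]
      · simp [chi, hei, hej]
      · intro k _ hk
        have : e ∉ E k := by
          intro hek
          have : k ∈ ({i, j} : Set I) := by rw [hset]; exact hek
          apply hk
          simpa using this
        simp [chi, this]
    rw [h0] at hs
    exact z2_eq _ _ hs.symm
  obtain ⟨i0, hi0⟩ := (Set.ne_univ_iff_exists_notMem F).1 hF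
  ext i
  have hr := hconn.preconnected i i0
  obtain ⟨w⟩ := hr
  have : x i = x i0 := by
    clear hi0
    induction w with
    | nil => rfl
    | cons hadj _ ih =>
      rw [← ih]
      rw [SimpleGraph.fromRel_adj] at hadj
      rcases hadj with ⟨hne, h | h⟩
      · exact key _ _ hne h
      · exact (key _ _ hne.symm h).symm
  rw [this, hx _ hi0]; rfl

theorem res_adj {G : SimpleGraph V} {E : I → Set (Sym2 V)} {F : Set I}
    {M N : {M : Set (Sym2 V) // IsPM G M}} (h : (resGraph G E F).Adj M N) :
    ∃ i ∈ F, symmDiff M.1 N.1 = E i := by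
  unfold resGraph at h
  rw [SimpleGraph.fromRel_adj] at h
  rcases h with ⟨_, h | h⟩
  · exact h
  · rw [symmDiff_comm]; exact h

theorem fun_self {A : Type*} (f : A → ZMod 2) : f + f = 0 := by
  ext e; exact z2_self _

theorem fun_eq {A : Type*} {f g : A → ZMod 2} (h : f + g = 0) : f = g := by
  ext e; exact z2_eq _ _ (congrFun h e)

theorem exists_coord [Fintype I] {G : SimpleGraph V} {E : I → Set (Sym2 V)} {F : Set I}
    {M N : {M : Set (Sym2 V) // IsPM G M}} (h : (resGraph G E F).Reachable M N) :
    ∃ x : I → ZMod 2, (∀ i, i ∉ F → x i = 0) ∧ chi M.1 + chi N.1 = phi E x := by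
  classical
  obtain ⟨w⟩ := h
  induction w with
  | nil => exact ⟨0, by simp, by rw [fun_self]; ext e; simp [phi]⟩
  | @cons u v w hadj _ ih =>
    obtain ⟨x, hx, hs⟩ := ih
    obtain ⟨i, hi, hd⟩ := res_adj hadj
    refine ⟨Pi.single i 1 + x, ?_, ?_⟩
    · intro k hk
      have : k ≠ i := by rintro rfl; exact hk hi
      simp [this, hx k hk]
    · rw [phi_add, phi_single, ← hd, chi_symmDiff, ← hs]
      have := fun_self (chi v.1)
      calc chi u.1 + chi w.1 = chi u.1 + (chi v.1 + chi v.1) + chi w.1 := by rw [this, add_zero]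
        _ = _ := by abel

/-- Every connected component `H` of the resonance graph `R(G;F)` is an
induced cubical graph: there exist `n : ℕ` and an injective map from the vertex set of
`H` into `{0,1}^n` under which two vertices of `H` are adjacent in `R(G;F)` iff their
images differ in exactly one coordinate. -/
theorem statement5 [Fintype V] [Fintype I] (G : SimpleGraph V)
    (E : I → Set (Sym2 V)) (hface : IsFaceSystem G E)
    (F : Set I) (hF : F ≠ Set.univ) (hFcyc : ∀ i ∈ F, IsEvenCycleSet G (E i))
    (H : (resGraph G E F).ConnectedComponent) :
    ∃ (n : ℕ)
      (ℓ : {M : {M : Set (Sym2 V) // IsPM G M} //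
            (resGraph G E F).connectedComponentMk M = H} → (Fin n → Bool)),
      Function.Injective ℓ ∧
      ∀ M₁ M₂, ((resGraph G E F).Adj M₁.1 M₂.1 ↔ ∃! j : Fin n, ℓ M₁ j ≠ ℓ M₂ j) := by
  classical
  obtain ⟨M0, rfl⟩ := H.exists_rep
  have hex : ∀ M : {M : {M : Set (Sym2 V) // IsPM G M} //
      (resGraph G E F).connectedComponentMk M = Quot.mk _ M0},
      ∃ x : I → ZMod 2, (∀ i, i ∉ F → x i = 0) ∧ chi M.1.1 + chi M0.1 = phi E x := by
    intro M
    exact exists_coord (SimpleGraph.ConnectedComponent.exact M.2)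
  choose x hx hs using hex
  have hsum : ∀ M₁ M₂, phi E (x M₁ + x M₂) = chi M₁.1.1 + chi M₂.1.1 := by
    intro M₁ M₂
    rw [phi_add, ← hs, ← hs]
    have := fun_self (chi M0.1)
    calc _ = chi M₁.1.1 + chi M₂.1.1 + (chi M0.1 + chi M0.1) := by abel
      _ = _ := by rw [this, add_zero]
  have hb : ∀ a b : ZMod 2, (decide (a = 1) = decide (b = 1)) ↔ a = b := by decide
  refine ⟨Fintype.card I, fun M j => decide (x M ((Fintype.equivFin I).symm j) = 1), ?_, ?_⟩
  · intro M₁ M₂ h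
    have hxx : x M₁ = x M₂ := by
      ext i
      have := congrFun h (Fintype.equivFin I i)
      simpa only [Equiv.symm_apply_apply, hb] using this
    have h2 := hsum M₁ M₂
    rw [hxx, fun_self] at h2
    have h3 : phi E (0 : I → ZMod 2) = 0 := by ext e; simp [phi]
    rw [h3] at h2
    exact Subtype.ext (Subtype.ext (chi_inj (fun_eq h2.symm)))
  · intro M₁ M₂
    have hiff : (∃! j : Fin (Fintype.card I),
        decide (x M₁ ((Fintype.equivFin I).symm j) = 1) ≠
          decide (x M₂ ((Fintype.equivFin I).symm j) = 1)) ↔ ∃! i : I, x M₁ i ≠ x M₂ i := by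
      simp only [ne_eq, hb]
      exact (Fintype.equivFin I).symm.existsUnique_congr (fun {_} => Iff.rfl)
    show _ ↔ (∃! j : Fin (Fintype.card I),
        decide (x M₁ ((Fintype.equivFin I).symm j) = 1) ≠
          decide (x M₂ ((Fintype.equivFin I).symm j) = 1))
    rw [hiff]
    constructor
    · intro h
      obtain ⟨i, hi, hd⟩ := res_adj h
      have hz : x M₁ + x M₂ + Pi.single i 1 = 0 := by
        apply phi_ker hface hF
        · intro k hk
          have : k ≠ i := by rintro rfl; exact hk hi
          simp [this, hx _ k hk]
        · rw [phi_add, hsum, phi_single, ← hd, chi_symmDiff, fun_self]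
      have hz := fun_eq hz
      have hne : ∀ a b : ZMod 2, a + b = 1 → a ≠ b := by decide
      refine ⟨i, hne _ _ ?_, ?_⟩
      · simpa using congrFun hz i
      · intro k hk
        by_contra hki
        apply hk
        have := congrFun hz k
        simp only [Pi.add_apply, Pi.single_eq_of_ne hki] at this
        exact z2_eq _ _ this
    · rintro ⟨i, hi, hu⟩
      have hz : x M₁ + x M₂ = Pi.single i 1 := by
        ext k
        by_cases hki : k = i
        · subst hki
          have hne : ∀ a b : ZMod 2, a ≠ b → a + b = 1 := by decide
          simpa using hne _ _ hi
        · have : x M₁ k = x M₂ k := by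
            by_contra hc
            exact hki (hu k hc)
          simp [Pi.single_eq_of_ne hki, this, z2_self]
      have hiF : i ∈ F := by
        by_contra hc
        exact hi (by rw [hx _ i hc, hx _ i hc])
      have hd : symmDiff M₁.1.1 M₂.1.1 = E i := by
        apply chi_inj
        rw [chi_symmDiff, ← hsum, hz, phi_single]
      unfold resGraph
      rw [SimpleGraph.fromRel_adj]
      refine ⟨?_, Or.inl ⟨i, hiF, hd⟩⟩
      intro heq
      have hn := (hFcyc i hiF).1.2.1
      rw [← hd, heq, symmDiff_self] at hn
      exact Set.not_nonempty_empty hn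
end

section
/- Let S be a Clar cover of G with respect to F having exactly k cycle components. Then the set X(S) of perfect matchings compatible with S has exactly 2^k elements, and the subgraph of the resonance graph R(G;F) induced on X(S) is isomorphic to the k-dimensional hypercube Q_k. -/
open SimpleGraph

variable {V : Type*}

/-- The resonance graph `R(G;F)` of `G` with respect to a family `F` of even cycles:
vertices are the perfect matchings of `G`, two of them being adjacent iff their
symmetric difference belongs to `F`. -/
def resGraphFam (G : SimpleGraph V) (F : Set (Set (Sym2 V))) :
    SimpleGraph {M : Set (Sym2 V) // IsPM G M} :=
  SimpleGraph.fromRel fun M₁ M₂ => symmDiff M₁.1 M₂.1 ∈ F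

/-- The vertex `v` is incident with some edge of the edge set `C`. -/
def coveredBy (C : Set (Sym2 V)) (v : V) : Prop := ∃ e ∈ C, v ∈ e

/-- `S` is a Clar cover of `G` with respect to `F`, decomposed into its set `𝒞` of cycle
components (cycles belonging to `F`) and its set `M₀` of single-edge components: the
cycles are pairwise vertex-disjoint, vertex-disjoint from the matching `M₀`, and every
vertex of `G` is covered.  Equivalently, every connected component of the spanning
subgraph `(V(G), S)` is a single edge or a cycle belonging to `F`. -/
def IsClarDecomp (G : SimpleGraph V) (F : Set (Set (Sym2 V)))
    (S : Set (Sym2 V)) (𝒞 : Set (Set (Sym2 V))) (M₀ : Set (Sym2 V)) : Prop :=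
  𝒞 ⊆ F ∧ M₀ ⊆ G.edgeSet ∧ S = M₀ ∪ ⋃₀ 𝒞 ∧
  (∀ v : V, {e ∈ M₀ | v ∈ e}.Subsingleton) ∧
  (∀ C₁ ∈ 𝒞, ∀ C₂ ∈ 𝒞, C₁ ≠ C₂ → ∀ v : V, ¬ (coveredBy C₁ v ∧ coveredBy C₂ v)) ∧
  (∀ C ∈ 𝒞, ∀ v : V, coveredBy C v → ¬ coveredBy M₀ v) ∧
  (∀ v : V, coveredBy S v)

/-- `M` is compatible with the Clar cover decomposed as `(𝒞, M₀)`: every single-edge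
component belongs to `M` and `M ∩ C` is a perfect matching of every cycle component
`C`. -/
def ClarCompatible (𝒞 : Set (Set (Sym2 V))) (M₀ : Set (Sym2 V))
    (M : Set (Sym2 V)) : Prop :=
  M₀ ⊆ M ∧ ∀ C ∈ 𝒞, ∀ v : V, coveredBy C v → ∃! e, e ∈ M ∩ C ∧ v ∈ e

/-- The `k`-dimensional hypercube `Q_k`: vertices are the elements of `{0,1}^k`, two of
them being adjacent iff they differ in exactly one coordinate. -/
def hypercube (k : ℕ) : SimpleGraph (Fin k → Bool) :=
  SimpleGraph.fromRel fun a b => ∃! j : Fin k, a j ≠ b j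

/-- `P` is a perfect matching of the cycle `C`. -/
def PMof (C P : Set (Sym2 V)) : Prop :=
  P ⊆ C ∧ ∀ v : V, coveredBy C v → ∃! e, e ∈ P ∧ v ∈ e

lemma mem_support_of_covered {G : SimpleGraph V} {C : Set (Sym2 V)} (hC : C ⊆ G.edgeSet) {v : V}
    (hv : coveredBy C v) : v ∈ (fromEdgeSet C).support := by
  obtain ⟨e, he, hve⟩ := hv
  obtain ⟨w, rfl⟩ := Sym2.mem_iff_exists.1 hve
  have := hC he
  rw [mem_edgeSet] at this
  exact ⟨w, (fromEdgeSet_adj C).2 ⟨he, this.ne⟩⟩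

lemma two_edges {G : SimpleGraph V} {C : Set (Sym2 V)} (hC : IsCycleSet G C) {v : V}
    (hv : coveredBy C v) : ∃ e₁ e₂, e₁ ≠ e₂ ∧ ∀ e, (e ∈ C ∧ v ∈ e) ↔ (e = e₁ ∨ e = e₂) := by
  have h := hC.2.2.1 v (mem_support_of_covered hC.1 hv)
  obtain ⟨a, b, hab, h⟩ := Set.ncard_eq_two.1 h
  have key : ∀ w, s(v, w) ∈ C ↔ (w = a ∨ w = b) := by
    intro w
    have : w ∈ (fromEdgeSet C).neighborSet v ↔ w ∈ ({a, b} : Set V) := by rw [h]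
    simp only [mem_neighborSet, fromEdgeSet_adj, Set.mem_insert_iff, Set.mem_singleton_iff] at this
    rw [← this]
    refine ⟨fun hw => ⟨hw, ?_⟩, fun hw => hw.1⟩
    have := hC.1 hw
    rw [mem_edgeSet] at this
    exact this.ne
  refine ⟨s(v, a), s(v, b), ?_, ?_⟩
  · intro h
    exact hab (Sym2.congr_right.1 h)
  · intro e
    constructor
    · rintro ⟨he, hve⟩
      obtain ⟨w, rfl⟩ := Sym2.mem_iff_exists.1 hve
      rcases (key w).1 he with rfl | rfl <;> simp
    · rintro (rfl | rfl)
      · exact ⟨(key a).2 (Or.inl rfl), by simp⟩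
      · exact ⟨(key b).2 (Or.inr rfl), by simp⟩

lemma reach_ind {H : SimpleGraph V} {p : V → Prop} (hp : ∀ v w, H.Adj v w → p v → p w)
    {v w : V} (h : H.Reachable v w) (hv : p v) : p w := by
  obtain ⟨q⟩ := h
  induction q with
  | nil => exact hv
  | cons h _ ih => exact ih (hp _ _ h hv)

lemma PMof.compl {G : SimpleGraph V} {C P : Set (Sym2 V)} (hC : IsCycleSet G C) (hP : PMof C P) :
    PMof C (C \ P) := by
  refine ⟨Set.sdiff_subset, fun v hv => ?_⟩
  obtain ⟨e₁, e₂, hne, h⟩ := two_edges hC hv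
  obtain ⟨e, ⟨he, hve⟩, hu⟩ := hP.2 v hv
  have h1 := (h e₁).2 (Or.inl rfl)
  have h2 := (h e₂).2 (Or.inr rfl)
  simp only at hu
  rcases (h e).1 ⟨hP.1 he, hve⟩ with rfl | rfl
  · refine ⟨e₂, ⟨⟨h2.1, fun hh => hne (hu _ ⟨hh, h2.2⟩).symm⟩, h2.2⟩, ?_⟩
    rintro e' ⟨⟨h3, h4⟩, h5⟩
    rcases (h e').1 ⟨h3, h5⟩ with rfl | rfl
    · exact absurd he h4
    · rfl
  · refine ⟨e₁, ⟨⟨h1.1, fun hh => hne (hu _ ⟨hh, h1.2⟩)⟩, h1.2⟩, ?_⟩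
    rintro e' ⟨⟨h3, h4⟩, h5⟩
    rcases (h e').1 ⟨h3, h5⟩ with rfl | rfl
    · rfl
    · exact absurd he h4

lemma PMof.local {G : SimpleGraph V} {C P : Set (Sym2 V)} (hC : IsCycleSet G C) (hP : PMof C P)
    {e f : Sym2 V} (he : e ∈ C) (hf : f ∈ C) {v : V} (hve : v ∈ e) (hvf : v ∈ f) (hef : e ≠ f) :
    e ∈ P ↔ f ∉ P := by
  have hv : coveredBy C v := ⟨e, he, hve⟩
  constructor
  · intro h1 h2
    exact hef ((hP.2 v hv).unique ⟨h1, hve⟩ ⟨h2, hvf⟩)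
  · intro h1
    by_contra h2
    exact hef (((hP.compl hC).2 v hv).unique ⟨⟨he, h2⟩, hve⟩ ⟨⟨hf, h1⟩, hvf⟩)

lemma PMof.agree {G : SimpleGraph V} {C P Q : Set (Sym2 V)} (hC : IsCycleSet G C)
    (hP : PMof C P) (hQ : PMof C Q) {e₀ : Sym2 V} (he₀ : e₀ ∈ C) (h₀ : e₀ ∈ P ↔ e₀ ∈ Q) :
    P = Q := by
  obtain ⟨v₀, hv₀⟩ : ∃ v, v ∈ e₀ := by
    induction e₀ with | h a b => exact ⟨a, by simp⟩
  have step : ∀ v e, e ∈ C → v ∈ e → (e ∈ P ↔ e ∈ Q) → ∀ f ∈ C, v ∈ f → (f ∈ P ↔ f ∈ Q) := by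
    intro v e he hve h f hf hvf
    by_cases hef : e = f
    · rwa [← hef]
    · have h1 := hP.local hC he hf hve hvf hef
      have h2 := hQ.local hC he hf hve hvf hef
      tauto
  have all : ∀ f ∈ C, (f ∈ P ↔ f ∈ Q) := by
    intro f hf
    obtain ⟨w, hw⟩ : ∃ v, v ∈ f := by
      induction f with | h a b => exact ⟨a, by simp⟩
    have hr := hC.2.2.2 v₀ (mem_support_of_covered hC.1 ⟨e₀, he₀, hv₀⟩) w
      (mem_support_of_covered hC.1 ⟨f, hf, hw⟩)
    refine reach_ind (p := fun v => ∀ f ∈ C, v ∈ f → (f ∈ P ↔ f ∈ Q)) ?_ hr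
      (step v₀ e₀ he₀ hv₀ h₀) f hf hw
    intro v w hvw hp
    rw [fromEdgeSet_adj] at hvw
    exact step w s(v, w) hvw.1 (by simp) (hp _ hvw.1 (by simp))
  ext f
  constructor
  · intro h; exact (all f (hP.1 h)).1 h
  · intro h; exact (all f (hQ.1 h)).2 h

lemma PMof.eq_or {G : SimpleGraph V} {C P Q : Set (Sym2 V)} (hC : IsCycleSet G C)
    (hP : PMof C P) (hQ : PMof C Q) : Q = P ∨ Q = C \ P := by
  obtain ⟨e, he⟩ := hC.2.1
  by_cases h : e ∈ P ↔ e ∈ Q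
  · exact Or.inl (hP.agree hC hQ he h).symm
  · refine Or.inr ((hP.compl hC).agree hC hQ he ?_).symm
    simp only [Set.mem_sdiff, he, true_and]
    tauto

lemma exists_PMof [Finite V] {G : SimpleGraph V} {C : Set (Sym2 V)} (hC : IsEvenCycleSet G C) :
    ∃ P, PMof C P := by
  classical
  obtain ⟨hC, hev⟩ := hC
  set H := fromEdgeSet C with hH
  have hcyc : H.IsCycles := by
    rintro v ⟨w, hw⟩
    exact hC.2.2.1 v ⟨w, hw⟩
  have hCe : H.edgeSet = C := by
    rw [hH, edgeSet_fromEdgeSet]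
    ext e
    simp only [Set.mem_sdiff]
    refine ⟨fun h => h.1, fun h => ⟨h, ?_⟩⟩
    exact G.not_isDiag_of_mem_edgeSet (hC.1 h)
  obtain ⟨e₀, he₀⟩ := hC.2.1
  obtain ⟨v₀, hv₀⟩ : ∃ v, v ∈ e₀ := by
    induction e₀ with | h a b => exact ⟨a, by simp⟩
  have hs₀ := mem_support_of_covered hC.1 ⟨e₀, he₀, hv₀⟩
  obtain ⟨p, hp, hpv⟩ := hcyc.exists_cycle_toSubgraph_verts_eq_connectedComponentSupp
    (c := H.connectedComponentMk v₀) (v := v₀) (by simp) hs₀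
  have hcov : ∀ v, coveredBy C v → v ∈ p.support := by
    intro v hv
    rw [← Walk.mem_verts_toSubgraph, hpv, ConnectedComponent.mem_supp_iff,
      ConnectedComponent.eq]
    exact hC.2.2.2 _ (mem_support_of_covered hC.1 hv) _ hs₀
  have hCp : C = {e | e ∈ p.edges} := by
    ext e
    constructor
    · induction e with
      | h a b =>
        intro h
        have ha := hcov a ⟨_, h, by simp⟩
        rw [← Walk.mem_verts_toSubgraph] at ha
        have h' : H.Adj a b := by rwa [← hCe] at h
        haveI : H.LocallyFinite := fun _ => Fintype.ofFinite _
        rw [← hp.adj_toSubgraph_iff_of_isCycles hcyc ha] at h'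
        rwa [Walk.adj_toSubgraph_iff_mem_edges] at h'
    · intro h
      rw [← hCe]
      exact p.edges_subset_edgeSet h
  have hlen : C.ncard = p.length := by
    rw [hCp, ← p.length_edges, ← List.toFinset_card_of_nodup hp.edges_nodup,
      ← Set.ncard_coe_finset]
    congr 1
    ext e
    simp
  rw [hlen] at hev
  obtain ⟨n, hn⟩ := hev
  have h3 := hp.three_le_length
  have hinj : ∀ i j, i < p.length → j < p.length → p.getVert i = p.getVert j → i = j := by
    intro i j hi hj h
    exact hp.getVert_injOn' (by rw [Set.mem_ofPred_eq]; lia) (by rw [Set.mem_ofPred_eq]; lia) h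
  have hmem : ∀ i, i < p.length → s(p.getVert i, p.getVert (i + 1)) ∈ C := by
    intro i hi
    rw [← hCe]
    exact p.adj_getVert_succ hi
  refine ⟨{e | ∃ i, i < n ∧ e = s(p.getVert (2 * i), p.getVert (2 * i + 1))}, ?_, ?_⟩
  · rintro e ⟨i, hi, rfl⟩
    exact hmem _ (by lia)
  · intro v hv
    obtain ⟨j, hj, hjl⟩ : ∃ j, p.getVert j = v ∧ j < p.length := by
      obtain ⟨j, hj, hjl⟩ := Walk.mem_support_iff_exists_getVert.1 (hcov v hv)
      by_cases h : j = p.length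
      · refine ⟨0, ?_, by lia⟩
        rw [← hj, h]; simp
      · exact ⟨j, hj, by lia⟩
    refine ⟨s(p.getVert (2 * (j / 2)), p.getVert (2 * (j / 2) + 1)), ⟨⟨j / 2, by lia, rfl⟩, ?_⟩, ?_⟩
    · rw [Sym2.mem_iff, ← hj]
      rcases Nat.mod_two_eq_zero_or_one j with h | h
      · left; congr 1; lia
      · right; congr 1; lia
    · rintro e ⟨⟨i, hi, rfl⟩, hve⟩
      have : i = j / 2 := by
        rw [Sym2.mem_iff, ← hj] at hve
        rcases hve with h | h
        · have := hinj _ _ hjl (by lia) h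
          lia
        · have := hinj _ _ hjl (by lia) h
          lia
      rw [this]


/-- If `S` is a Clar cover of `G` with respect to `F` having exactly
`k` cycle components, then the set `X(S)` of perfect matchings compatible with `S` has
exactly `2 ^ k` elements, and the subgraph of `R(G;F)` induced on `X(S)` is isomorphic
to the hypercube `Q_k`. -/
theorem statement7 [Fintype V] (G : SimpleGraph V)
    (F : Set (Set (Sym2 V))) (hFfin : F.Finite)
    (hFcyc : ∀ C ∈ F, IsEvenCycleSet G C)
    (S : Set (Sym2 V)) (𝒞 : Set (Set (Sym2 V))) (M₀ : Set (Sym2 V))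
    (hS : IsClarDecomp G F S 𝒞 M₀) (k : ℕ) (hk : 𝒞.ncard = k)
    (X : Set {M : Set (Sym2 V) // IsPM G M})
    (hX : X = {M : {M : Set (Sym2 V) // IsPM G M} | ClarCompatible 𝒞 M₀ M.1}) :
    X.ncard = 2 ^ k ∧ Nonempty (((resGraphFam G F).induce X) ≃g hypercube k) := by
  classical
  obtain ⟨h𝒞F, hM₀G, hSeq, hM₀, hdisj, hdisj₀, hcovS⟩ := hS
  have exv : ∀ e : Sym2 V, ∃ v, v ∈ e := by
    intro e
    induction e with | h a b => exact ⟨a, by simp⟩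
  have hcard : Nat.card 𝒞 = k := hk
  let c' : Fin k ≃ 𝒞 := (Finite.equivFinOfCardEq hcard).symm
  let c : Fin k → Set (Sym2 V) := fun j => (c' j).1
  have hc𝒞 : ∀ j, c j ∈ 𝒞 := fun j => (c' j).2
  have hcinj : ∀ i j, c i = c j → i = j := fun i j h => c'.injective (Subtype.ext h)
  have hcsurj : ∀ C ∈ 𝒞, ∃ j, c j = C := by
    intro C hC
    obtain ⟨j, hj⟩ := c'.surjective ⟨C, hC⟩
    exact ⟨j, congrArg Subtype.val hj⟩
  clear_value c
  have hcE : ∀ j, IsEvenCycleSet G (c j) := fun j => hFcyc _ (h𝒞F (hc𝒞 j))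
  have hcC : ∀ j, IsCycleSet G (c j) := fun j => (hcE j).1
  choose P hP using fun j => exists_PMof (hcE j)
  -- disjointness facts
  have d1 : ∀ i j v, coveredBy (c i) v → coveredBy (c j) v → i = j := by
    intro i j v h1 h2
    by_contra h
    exact hdisj _ (hc𝒞 i) _ (hc𝒞 j) (fun hh => h (hcinj _ _ hh)) v ⟨h1, h2⟩
  have d2 : ∀ i j e, e ∈ c i → e ∈ c j → i = j := by
    intro i j e h1 h2
    obtain ⟨v, hv⟩ := exv e
    exact d1 i j v ⟨e, h1, hv⟩ ⟨e, h2, hv⟩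
  have d3 : ∀ j v, coveredBy (c j) v → ¬ coveredBy M₀ v := fun j => hdisj₀ _ (hc𝒞 j)
  have d4 : ∀ j e, e ∈ c j → e ∉ M₀ := by
    intro j e h1 h2
    obtain ⟨v, hv⟩ := exv e
    exact d3 j v ⟨e, h1, hv⟩ ⟨e, h2, hv⟩
  have hcov : ∀ v, coveredBy M₀ v ∨ ∃ j, coveredBy (c j) v := by
    intro v
    obtain ⟨e, he, hve⟩ := hcovS v
    rw [hSeq] at he
    rcases he with he | ⟨C, hC, he⟩
    · exact Or.inl ⟨e, he, hve⟩
    · obtain ⟨j, rfl⟩ := hcsurj C hC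
      exact Or.inr ⟨j, e, he, hve⟩
  let sel : (Fin k → Bool) → Fin k → Set (Sym2 V) := fun a j => if a j then P j else c j \ P j
  have hsel : ∀ a j, PMof (c j) (sel a j) := by
    intro a j
    by_cases h : a j
    · simpa [sel, h] using hP j
    · simpa [sel, h] using (hP j).compl (hcC j)
  have hselmem : ∀ a j e, e ∈ sel a j ↔ e ∈ c j ∧ (e ∈ P j ↔ a j = true) := by
    intro a j e
    have := @(hP j).1 e
    by_cases h : a j
    · simp only [sel, h, if_true, iff_true]; tauto
    · simp only [sel, h, Set.mem_sdiff]; simp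
  let M : (Fin k → Bool) → Set (Sym2 V) := fun a => M₀ ∪ ⋃ j, sel a j
  have hM : ∀ a e, e ∈ M a ↔ e ∈ M₀ ∨ ∃ j, e ∈ sel a j := by
    intro a e; simp [M]
  have hMc : ∀ a j e, e ∈ M a ∩ c j ↔ e ∈ sel a j := by
    intro a j e
    constructor
    · rintro ⟨h1, h2⟩
      rcases (hM a e).1 h1 with h | ⟨i, h⟩
      · exact absurd h (d4 j e h2)
      · obtain rfl := d2 i j e ((hsel a i).1 h) h2
        exact h
    · intro h
      exact ⟨(hM a e).2 (Or.inr ⟨j, h⟩), (hsel a j).1 h⟩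
  clear_value M sel
  have hPM : ∀ a, IsPM G (M a) := by
    intro a
    constructor
    · intro e he
      rcases (hM a e).1 he with h | ⟨i, h⟩
      · exact hM₀G h
      · exact (hcC i).1 ((hsel a i).1 h)
    · intro v
      rcases hcov v with ⟨e, he, hve⟩ | ⟨j, hj⟩
      · refine ⟨e, ⟨(hM a e).2 (Or.inl he), hve⟩, ?_⟩
        rintro f ⟨hf, hvf⟩
        rcases (hM a f).1 hf with h | ⟨i, h⟩
        · exact hM₀ v ⟨h, hvf⟩ ⟨he, hve⟩
        · exact absurd ⟨e, he, hve⟩ (d3 i v ⟨f, (hsel a i).1 h, hvf⟩)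
      · obtain ⟨e, ⟨he, hve⟩, hu⟩ := (hsel a j).2 v hj
        refine ⟨e, ⟨(hM a e).2 (Or.inr ⟨j, he⟩), hve⟩, ?_⟩
        rintro f ⟨hf, hvf⟩
        rcases (hM a f).1 hf with h | ⟨i, h⟩
        · exact absurd ⟨f, h, hvf⟩ (d3 j v hj)
        · obtain rfl := d1 i j v ⟨f, (hsel a i).1 h, hvf⟩ hj
          exact hu f ⟨h, hvf⟩
  have hcompat : ∀ a, ClarCompatible 𝒞 M₀ (M a) := by
    intro a
    refine ⟨fun e he => (hM a e).2 (Or.inl he), ?_⟩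
    intro C hC v hv
    obtain ⟨j, rfl⟩ := hcsurj C hC
    simp only [hMc]
    exact (hsel a j).2 v hv
  let φ : (Fin k → Bool) → X := fun a => ⟨⟨M a, hPM a⟩, by rw [hX]; exact hcompat a⟩
  have hφinj : Function.Injective φ := by
    intro a b hab
    have hab : M a = M b := congrArg (fun x => x.1.1) hab
    funext j
    obtain ⟨e, he⟩ := (hcC j).2.1
    have h1 := hMc a j e
    rw [hab, hMc b j e, hselmem, hselmem] at h1
    rw [Bool.eq_iff_iff]
    tauto
  have hφsurj : Function.Surjective φ := by
    rintro ⟨⟨N, hN⟩, hNX⟩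
    have hNc : ClarCompatible 𝒞 M₀ N := by rw [hX] at hNX; exact hNX
    have hNP : ∀ j, PMof (c j) (N ∩ c j) :=
      fun j => ⟨Set.inter_subset_right, hNc.2 _ (hc𝒞 j)⟩
    have hex : ∀ j, ∃ t : Bool, ∀ e, e ∈ N ∩ c j ↔ e ∈ c j ∧ (e ∈ P j ↔ t = true) := by
      intro j
      rcases (hP j).eq_or (hcC j) (hNP j) with h | h
      · refine ⟨true, fun e => ?_⟩
        have := @(hP j).1 e
        rw [h]; simp only [iff_true]; tauto
      · refine ⟨false, fun e => ?_⟩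
        rw [h]; simp
    choose a ha using hex
    refine ⟨a, ?_⟩
    apply Subtype.ext
    apply Subtype.ext
    change M a = N
    have hsub : M a ⊆ N := by
      intro e he
      rcases (hM a e).1 he with h | ⟨i, h⟩
      · exact hNc.1 h
      · exact ((ha i e).2 ((hselmem a i e).1 h)).1
    refine Set.Subset.antisymm hsub ?_
    intro e he
    obtain ⟨v, hv⟩ := exv e
    obtain ⟨f, ⟨hf, hvf⟩, -⟩ := (hPM a).2 v
    obtain rfl := (hN.2 v).unique ⟨he, hv⟩ ⟨hsub hf, hvf⟩
    exact hf
  have hsymm : ∀ a b e, e ∈ symmDiff (M a) (M b) ↔ ∃ j, a j ≠ b j ∧ e ∈ c j := by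
    intro a b e
    rw [Set.mem_symmDiff]
    constructor
    · intro h
      have h0 : e ∉ M₀ := by
        intro h0
        have h1 := (hM a e).2 (Or.inl h0)
        have h2 := (hM b e).2 (Or.inl h0)
        tauto
      have : ∃ j, e ∈ c j := by
        rcases h with ⟨h, -⟩ | ⟨h, -⟩
        · rcases (hM a e).1 h with h | ⟨i, h⟩
          · exact absurd h h0
          · exact ⟨i, (hsel a i).1 h⟩
        · rcases (hM b e).1 h with h | ⟨i, h⟩
          · exact absurd h h0
          · exact ⟨i, (hsel b i).1 h⟩
      obtain ⟨j, hj⟩ := this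
      refine ⟨j, fun hab => ?_, hj⟩
      have h1 := hMc a j e
      have h2 := hMc b j e
      rw [hselmem, Set.mem_inter_iff] at h1 h2
      rw [hab] at h1
      tauto
    · rintro ⟨j, hab, hj⟩
      have h1 := hMc a j e
      have h2 := hMc b j e
      rw [hselmem, Set.mem_inter_iff] at h1 h2
      rw [Ne, Bool.eq_iff_iff] at hab
      tauto
  have hadj : ∀ a b, symmDiff (M a) (M b) ∈ F ↔ ∃! j, a j ≠ b j := by
    intro a b
    constructor
    · intro h
      have hU := (hFcyc _ h).1
      obtain ⟨e, he⟩ := hU.2.1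
      obtain ⟨j, hj, hej⟩ := (hsymm a b e).1 he
      refine ⟨j, hj, ?_⟩
      intro i hi
      obtain ⟨f, hf⟩ := (hcC i).2.1
      obtain ⟨v, hv⟩ := exv e
      obtain ⟨w, hw⟩ := exv f
      have hfU := (hsymm a b f).2 ⟨i, hi, hf⟩
      have hr := hU.2.2.2 v (mem_support_of_covered hU.1 ⟨e, he, hv⟩) w
        (mem_support_of_covered hU.1 ⟨f, hfU, hw⟩)
      have : coveredBy (c j) w := by
        refine reach_ind (p := fun x => coveredBy (c j) x) ?_ hr ⟨e, hej, hv⟩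
        intro x y hxy hx
        rw [fromEdgeSet_adj] at hxy
        obtain ⟨l, -, hl⟩ := (hsymm a b _).1 hxy.1
        obtain rfl := d1 l j x ⟨_, hl, by simp⟩ hx
        exact ⟨_, hl, by simp⟩
      exact d1 i j w ⟨f, hf, hw⟩ this
    · rintro ⟨j, hj, hu⟩
      have : symmDiff (M a) (M b) = c j := by
        ext e
        rw [hsymm]
        constructor
        · rintro ⟨i, hi, he⟩
          obtain rfl := hu i hi
          exact he
        · intro he
          exact ⟨j, hj, he⟩
      rw [this]
      exact h𝒞F (hc𝒞 j)
  let E : (Fin k → Bool) ≃ X := Equiv.ofBijective φ ⟨hφinj, hφsurj⟩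
  constructor
  · have : Nat.card X = 2 ^ k := by
      rw [← Nat.card_congr E]; simp
    exact this
  · refine ⟨RelIso.symm ⟨E, ?_⟩⟩
    intro a b
    have hne : (φ a).1 ≠ (φ b).1 ↔ a ≠ b := by
      rw [Ne, Ne, not_iff_not, ← Subtype.ext_iff, hφinj.eq_iff]
    change (resGraphFam G F).Adj (φ a).1 (φ b).1 ↔ (hypercube k).Adj a b
    rw [resGraphFam, hypercube, fromRel_adj, fromRel_adj, hne]
    change a ≠ b ∧ (symmDiff (M a) (M b) ∈ F ∨ symmDiff (M b) (M a) ∈ F) ↔ _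
    rw [hadj, hadj]
end

section
/- Let X be a set of perfect matchings of G such that the subgraph of the resonance graph R(G;F) induced on X is isomorphic to the k-dimensional hypercube Q_k. Then there exists a Clar cover S of G with respect to F having exactly k cycle components such that X = X(S), the set of perfect matchings compatible with S. -/
open SimpleGraph

variable {V : Type*} {I : Type*}

theorem pm_unique {G : SimpleGraph V} {M : Set (Sym2 V)} (h : IsPM G M) {v : V}
    {e e' : Sym2 V} (he : e ∈ M) (hv : v ∈ e) (he' : e' ∈ M) (hv' : v ∈ e') : e = e' :=
  (h.2 v).unique ⟨he, hv⟩ ⟨he', hv'⟩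

theorem cyc_ind {G : SimpleGraph V} {C : Set (Sym2 V)} (hC : IsCycleSet G C) (P : V → Prop)
    (hstep : ∀ v w, s(v, w) ∈ C → P v → P w) {v w : V} (hv : coveredBy C v)
    (hw : coveredBy C w) (hP : P v) : P w := by
  have hs : ∀ u, coveredBy C u → u ∈ (fromEdgeSet C).support := by
    rintro u ⟨e, he, hu⟩
    obtain ⟨x, rfl⟩ := Sym2.mem_iff_exists.1 hu
    rw [SimpleGraph.mem_support]
    refine ⟨x, ?_⟩
    rw [fromEdgeSet_adj]
    exact ⟨he, (G.mem_edgeSet.1 (hC.1 he)).ne⟩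
  obtain ⟨p⟩ := hC.2.2.2 v (hs v hv) w (hs w hw)
  clear hv hw
  induction p with
  | nil => exact hP
  | cons h p ih =>
    rw [fromEdgeSet_adj] at h
    exact ih (hstep _ _ h.1 hP)

/-- If `C = M Δ M'`, then the edges of `M`, `M'` at covered vertices lie in `C`. -/
theorem edge_mem {G : SimpleGraph V} {M M' C : Set (Sym2 V)} (h : IsPM G M) (h' : IsPM G M')
    (hC : symmDiff M M' = C) {v : V} (hv : coveredBy C v) {e : Sym2 V} (he : e ∈ M)
    (hve : v ∈ e) : e ∈ C := by
  obtain ⟨d, hd, hvd⟩ := hv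
  subst hC
  rw [Set.mem_symmDiff] at hd ⊢
  refine Or.inl ⟨he, fun he' => ?_⟩
  rcases hd with ⟨hd, hn⟩ | ⟨hd, hn⟩
  · exact hn (pm_unique h he hve hd hvd ▸ he')
  · exact hn (pm_unique h' he' hve hd hvd ▸ he)

theorem disj_aux {G : SimpleGraph V} {M₁ M₂ M₃ M₄ C D : Set (Sym2 V)}
    (h₁ : IsPM G M₁) (h₂ : IsPM G M₂) (h₃ : IsPM G M₃) (h₄ : IsPM G M₄)
    (hC : symmDiff M₁ M₂ = C) (hD : symmDiff M₂ M₃ = D) (hD' : symmDiff M₁ M₄ = D)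
    (hcyc : IsCycleSet G C) {v : V} (hv : coveredBy C v) (hv' : coveredBy D v) : C ⊆ D := by
  have key : ∀ u, coveredBy D u → ∀ e ∈ C, u ∈ e → e ∈ D := by
    intro u hu e he hue
    have he' := he
    rw [← hC, Set.mem_symmDiff] at he'
    rcases he' with ⟨h, _⟩ | ⟨h, _⟩
    · exact edge_mem h₁ h₄ hD' hu h hue
    · exact edge_mem h₂ h₃ hD hu h hue
  intro e he
  induction e using Sym2.ind with
  | _ x y =>
    have : coveredBy D x := cyc_ind hcyc (coveredBy D)
      (fun a b hab ha => ⟨_, key a ha _ hab (Sym2.mem_mk_left _ _), Sym2.mem_mk_right _ _⟩)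
      hv ⟨_, he, Sym2.mem_mk_left _ _⟩ hv'
    exact key x this _ he (Sym2.mem_mk_left _ _)

theorem two_faces [Finite I] {G : SimpleGraph V} {E : I → Set (Sym2 V)} (hface : IsFaceSystem G E)
    {e : Sym2 V} {i j l : I} (hij : i ≠ j) (hi : e ∈ E i) (hj : e ∈ E j) (hl : e ∈ E l) :
    l = i ∨ l = j := by
  have h2 := hface.2.1 e (hface.1 i hi)
  have hsub : ({i, j} : Set I) = {i : I | e ∈ E i} := by
    apply Set.eq_of_subset_of_ncard_le
    · rintro x (rfl | rfl) <;> assumption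
    · rw [h2, Set.ncard_pair hij]
    · exact Set.toFinite _
  have : l ∈ ({i, j} : Set I) := by rw [hsub]; exact hl
  simpa using this

theorem par_aux {p q r s A B C D : Prop} (hA : A ↔ p ∧ ¬q ∨ q ∧ ¬p) (hB : B ↔ q ∧ ¬r ∨ r ∧ ¬q)
    (hC : C ↔ s ∧ ¬r ∨ r ∧ ¬s) (hD : D ↔ p ∧ ¬s ∨ s ∧ ¬p) :
    (A → ¬B → ¬C → ¬D → False) ∧ (B → ¬A → ¬C → ¬D → False) ∧
    (C → ¬A → ¬B → ¬D → False) ∧ (D → ¬A → ¬B → ¬C → False) := by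
  by_cases p <;> by_cases q <;> by_cases r <;> by_cases s <;> simp_all

theorem sq_aux [Finite I] {G : SimpleGraph V} {E : I → Set (Sym2 V)} (hface : IsFaceSystem G E)
    {F : Set I} (hF : F ≠ Set.univ) {M₁ M₂ M₃ M₄ : Set (Sym2 V)}
    (h12 : symmDiff M₁ M₂ ∈ E '' F) (h23 : symmDiff M₂ M₃ ∈ E '' F)
    (h43 : symmDiff M₄ M₃ ∈ E '' F) (h14 : symmDiff M₁ M₄ ∈ E '' F)
    (h13 : M₁ ≠ M₃) (h24 : M₂ ≠ M₄) : symmDiff M₁ M₂ = symmDiff M₄ M₃ := by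
  by_contra hne
  obtain ⟨a, haF, ha⟩ := h12
  obtain ⟨b, hbF, hb⟩ := h23
  obtain ⟨c, hcF, hc⟩ := h43
  obtain ⟨d, hdF, hd⟩ := h14
  have hab : a ≠ b := by
    rintro rfl
    apply h13
    have : symmDiff M₂ M₁ = symmDiff M₂ M₃ := by rw [symmDiff_comm, ← ha, hb]
    exact symmDiff_right_injective _ this
  have had : a ≠ d := by
    rintro rfl
    exact h24 (symmDiff_right_injective _ (ha.symm.trans hd))
  have hcb : c ≠ b := by
    rintro rfl
    exact h24 (symmDiff_left_injective _ (hb.symm.trans hc))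
  have hcd : c ≠ d := by
    rintro rfl
    apply h13
    have : symmDiff M₄ M₁ = symmDiff M₄ M₃ := by rw [symmDiff_comm, ← hd, hc]
    exact symmDiff_right_injective _ this
  have hac : a ≠ c := by
    rintro rfl
    exact hne (ha.symm.trans hc)
  have hbd : b ≠ d := by
    rintro rfl
    apply hne
    have := hb.symm.trans hd
    ext e
    have := Set.ext_iff.1 this e
    simp only [Set.mem_symmDiff] at this ⊢
    tauto
  let T : Set I := {a, b, c, d}
  have hcl : ∀ i ∈ T, ∀ j, (SimpleGraph.fromRel fun i j : I => (E i ∩ E j).Nonempty).Adj i j →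
      j ∈ T := by
    intro i hi j hadj
    rw [SimpleGraph.fromRel_adj] at hadj
    obtain ⟨e, hei, hej⟩ : (E i ∩ E j).Nonempty := by
      rcases hadj.2 with h | h
      · exact h
      · rwa [Set.inter_comm]
    have hA : e ∈ E a ↔ e ∈ symmDiff M₁ M₂ := by rw [ha]
    have hB : e ∈ E b ↔ e ∈ symmDiff M₂ M₃ := by rw [hb]
    have hC : e ∈ E c ↔ e ∈ symmDiff M₄ M₃ := by rw [hc]
    have hD : e ∈ E d ↔ e ∈ symmDiff M₁ M₄ := by rw [hd]
    have hex : ∃ i' ∈ T, i ≠ i' ∧ e ∈ E i' := by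
      simp only [Set.mem_symmDiff] at hA hB hC hD
      obtain ⟨pa, pb, pc, pd⟩ := par_aux hA hB hC hD
      by_contra hcon
      push Not at hcon
      have qa := hcon a (by simp [T])
      have qb := hcon b (by simp [T])
      have qc := hcon c (by simp [T])
      have qd := hcon d (by simp [T])
      rcases hi with rfl | rfl | rfl | rfl
      · exact pa hei (qb hab) (qc hac) (qd had)
      · exact pb hei (qa hab.symm) (qc hcb.symm) (qd hbd)
      · exact pc hei (qa hac.symm) (qb hcb) (qd hcd)
      · exact pd hei (qa had.symm) (qb hbd.symm) (qc hcd.symm)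
    obtain ⟨i', hi', hne', he'⟩ := hex
    rcases two_faces hface hne' hei he' hej with rfl | rfl
    · exact hi
    · exact hi'
  apply hF
  rw [Set.eq_univ_iff_forall]
  intro x
  have hx : x ∈ T := by
    obtain ⟨p⟩ := hface.2.2.preconnected a x
    have ht : a ∈ T := by simp [T]
    clear_value T
    clear hab had hac ha haF hne
    induction p with
    | nil => exact ht
    | cons h p ih => exact ih (hcl _ ht _ h)
  rcases hx with rfl | rfl | rfl | rfl <;> assumption

def flp {k : ℕ} (a : Fin k → Bool) (j : Fin k) : Fin k → Bool := Function.update a j (!a j)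

theorem flp_flp {k : ℕ} (a : Fin k → Bool) (j : Fin k) : flp (flp a j) j = a := by
  simp [flp]

theorem flp_comm {k : ℕ} (a : Fin k → Bool) {i j : Fin k} (h : i ≠ j) :
    flp (flp a i) j = flp (flp a j) i := by
  simp only [flp]
  rw [Function.update_of_ne h.symm, Function.update_of_ne h, Function.update_comm h]

theorem flp_same {k : ℕ} (a : Fin k → Bool) (j : Fin k) : flp a j j = !a j := by simp [flp]

theorem flp_ne {k : ℕ} (a : Fin k → Bool) {i j : Fin k} (h : i ≠ j) : flp a i j = a j := by
  simp [flp, Function.update_of_ne h.symm]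

theorem hyper_adj {k : ℕ} (a : Fin k → Bool) (j : Fin k) : (hypercube k).Adj a (flp a j) := by
  rw [hypercube, SimpleGraph.fromRel_adj]
  refine ⟨fun h => ?_, Or.inl ⟨j, ?_, ?_⟩⟩
  · have := congrFun h j
    simp [flp_same] at this
  · simp [flp_same]
  · intro i hi
    by_contra hne
    exact hi (flp_ne a (Ne.symm hne)).symm

theorem flp_const {k : ℕ} {α : Type*} (g : (Fin k → Bool) → α) (h : ∀ a i, g (flp a i) = g a)
    (a b : Fin k → Bool) : g a = g b := by
  classical
  have : ∀ s : Finset (Fin k), g (fun i => if i ∈ s then a i else b i) = g b := by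
    intro s
    induction s using Finset.induction with
    | empty => simp
    | insert i s hi ih =>
      rw [← ih]
      by_cases hab : a i = b i
      · congr 1
        ext j
        by_cases hj : j = i
        · subst hj; simp [hi, hab]
        · simp [hj]
      · rw [← h (fun i => if i ∈ s then a i else b i) i]
        congr 1
        ext j
        by_cases hj : j = i
        · subst hj
          rw [flp_same]
          simp only [Finset.mem_insert_self, if_true, hi, if_false]
          cases h1 : a j <;> cases h2 : b j <;> simp_all
        · rw [flp_ne _ (Ne.symm hj)]
          simp [hj]
  simpa using this Finset.univ

/-- A perfect matching of a cycle `C = B Δ B'` agrees on `C` with `B` or `B'`. -/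
theorem agree {G : SimpleGraph V} {B B' C M : Set (Sym2 V)} (hB : IsPM G B) (hB' : IsPM G B')
    (hM : IsPM G M) (hC : symmDiff B B' = C) (hcyc : IsCycleSet G C)
    (hcomp : ∀ v : V, coveredBy C v → ∃! e, e ∈ M ∩ C ∧ v ∈ e) :
    (∀ e ∈ C, e ∈ M ↔ e ∈ B) ∨ (∀ e ∈ C, e ∈ M ↔ e ∈ B') := by
  have hx : ∀ e ∈ C, (e ∈ B ∧ e ∉ B') ∨ (e ∈ B' ∧ e ∉ B) := by
    intro e he
    rwa [← hC, Set.mem_symmDiff] at he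
  have hC' : symmDiff B' B = C := by rw [symmDiff_comm, hC]
  -- local agreement at a vertex
  have hstep : ∀ v w, s(v, w) ∈ C → (∃ e, v ∈ e ∧ e ∈ M ∧ e ∈ B) →
      (∃ e, w ∈ e ∧ e ∈ M ∧ e ∈ B) := by
    rintro v w hvw ⟨e, hve, heM, heB⟩
    rcases hx _ hvw with ⟨h1, h2⟩ | ⟨h1, h2⟩
    · have : e = s(v, w) := pm_unique hB heB hve h1 (Sym2.mem_mk_left _ _)
      subst this
      exact ⟨_, Sym2.mem_mk_right _ _, heM, heB⟩
    · obtain ⟨d, ⟨⟨hdM, hdC⟩, hwd⟩, _⟩ := hcomp w ⟨_, hvw, Sym2.mem_mk_right _ _⟩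
      refine ⟨d, hwd, hdM, ?_⟩
      rcases hx _ hdC with ⟨h3, _⟩ | ⟨h3, _⟩
      · exact h3
      · have hd : d = s(v, w) := pm_unique hB' h3 hwd h1 (Sym2.mem_mk_right _ _)
        subst hd
        have : e = s(v, w) := pm_unique hM heM hve hdM (Sym2.mem_mk_left _ _)
        exact absurd (this ▸ heB) h2
  by_cases hall : ∃ v, coveredBy C v ∧ ∃ e, v ∈ e ∧ e ∈ M ∧ e ∈ B
  · obtain ⟨v, hv, hPv⟩ := hall
    left
    intro e he
    induction e using Sym2.ind with
    | _ x y =>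
      obtain ⟨d, hxd, hdM, hdB⟩ := cyc_ind hcyc _ hstep hv
        ⟨_, he, Sym2.mem_mk_left x y⟩ hPv
      constructor
      · intro h
        exact pm_unique hM hdM hxd h (Sym2.mem_mk_left _ _) ▸ hdB
      · intro h
        exact pm_unique hB hdB hxd h (Sym2.mem_mk_left _ _) ▸ hdM
  · right
    intro e he
    induction e using Sym2.ind with
    | _ x y =>
      have hxc : coveredBy C x := ⟨_, he, Sym2.mem_mk_left x y⟩
      constructor
      · intro h
        rcases hx _ he with ⟨h1, _⟩ | ⟨h1, _⟩
        · exact absurd ⟨x, hxc, _, Sym2.mem_mk_left x y, h, h1⟩ hall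
        · exact h1
      · intro h
        obtain ⟨d, ⟨⟨hdM, hdC⟩, hxd⟩, _⟩ := hcomp x hxc
        rcases hx _ hdC with ⟨h1, _⟩ | ⟨h1, _⟩
        · exact absurd ⟨x, hxc, d, hxd, hdM, h1⟩ hall
        · exact pm_unique hB' h1 hxd h (Sym2.mem_mk_left _ _) ▸ hdM

/-- If `X` is a set of perfect matchings of `G` such that the subgraph
of `R(G;F)` induced on `X` is isomorphic to `Q_k`, then there is a Clar cover `S` of `G`
with respect to `F` (cycle components taken among the `E i`, `i ∈ F`) having exactly `k`
cycle components such that `X = X(S)`, the set of perfect matchings compatible with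
`S`. -/
theorem statement9 [Fintype V] [Fintype I] (G : SimpleGraph V)
    (E : I → Set (Sym2 V)) (hface : IsFaceSystem G E)
    (F : Set I) (hF : F ≠ Set.univ) (hFcyc : ∀ i ∈ F, IsEvenCycleSet G (E i))
    (k : ℕ) (X : Set {M : Set (Sym2 V) // IsPM G M})
    (hX : Nonempty (((resGraph G E F).induce X) ≃g hypercube k)) :
    ∃ (S : Set (Sym2 V)) (𝒞 : Set (Set (Sym2 V))) (M₀ : Set (Sym2 V)),
      IsClarDecomp G (E '' F) S 𝒞 M₀ ∧ 𝒞.ncard = k ∧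
      X = {M : {M : Set (Sym2 V) // IsPM G M} | ClarCompatible 𝒞 M₀ M.1} := by
  obtain ⟨φ⟩ := hX
  let f : (Fin k → Bool) → Set (Sym2 V) := fun a => (φ.symm a).1.1
  have hpm : ∀ a, IsPM G (f a) := fun a => (φ.symm a).1.2
  have hinj : Function.Injective f := fun a b h =>
    φ.symm.injective (Subtype.ext (Subtype.ext h))
  have hXf : ∀ M : {M : Set (Sym2 V) // IsPM G M}, M ∈ X ↔ ∃ a, f a = M.1 := by
    intro M
    constructor
    · intro h
      exact ⟨φ ⟨M, h⟩, by simp [f]⟩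
    · rintro ⟨a, ha⟩
      have : (φ.symm a).1 = M := Subtype.ext ha
      rw [← this]
      exact (φ.symm a).2
  have hadj : ∀ a j, symmDiff (f a) (f (flp a j)) ∈ E '' F := by
    intro a j
    have h : (resGraph G E F).Adj (φ.symm a).1 (φ.symm (flp a j)).1 :=
      (φ.symm.map_adj_iff).2 (hyper_adj a j)
    unfold resGraph at h
    rw [SimpleGraph.fromRel_adj] at h
    rcases h.2 with ⟨i, hi, h⟩ | ⟨i, hi, h⟩
    · exact ⟨i, hi, h.symm⟩
    · exact ⟨i, hi, by rw [symmDiff_comm]; exact h.symm⟩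
  clear_value f
  have hc : ∀ j a i, symmDiff (f (flp a i)) (f (flp (flp a i) j)) = symmDiff (f a) (f (flp a j)) := by
    intro j a i
    by_cases hij : i = j
    · subst hij
      rw [flp_flp, symmDiff_comm]
    · rw [flp_comm a hij]
      symm
      apply sq_aux hface hF (hadj _ _) (hadj _ _) _ (hadj _ _)
      · intro h
        have := congrFun (hinj h) j
        rw [flp_ne _ hij, flp_same] at this
        simp at this
      · intro h
        have := congrFun (hinj h) j
        rw [flp_ne _ hij, flp_same] at this
        simp at this
      · rw [← flp_comm a hij]
        exact hadj _ _
  let a₀ : Fin k → Bool := fun _ => false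
  let C : Fin k → Set (Sym2 V) := fun j => symmDiff (f a₀) (f (flp a₀ j))
  have hC : ∀ a j, symmDiff (f a) (f (flp a j)) = C j := fun a j =>
    flp_const (fun a => symmDiff (f a) (f (flp a j))) (hc j) a a₀
  have hCF : ∀ j, C j ∈ E '' F := fun j => hadj a₀ j
  have hcyc : ∀ j, IsCycleSet G (C j) := by
    intro j
    obtain ⟨i, hi, h⟩ := hCF j
    rw [← h]
    exact (hFcyc i hi).1
  clear_value C
  have hCinj : Function.Injective C := by
    intro i j h
    by_contra hij
    have := hinj (symmDiff_right_injective _ ((hC a₀ i).trans (h.trans (hC a₀ j).symm)))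
    have := congrFun this i
    rw [flp_same, flp_ne _ (Ne.symm hij)] at this
    simp at this
  have hdisj : ∀ i j, i ≠ j → ∀ v, coveredBy (C i) v → ¬ coveredBy (C j) v := by
    intro i j hij v hi hj
    apply hij
    apply hCinj
    apply Set.Subset.antisymm
    · exact disj_aux (hpm a₀) (hpm _) (hpm _) (hpm _) (hC a₀ i) (hC _ j) (hC a₀ j) (hcyc i) hi hj
    · exact disj_aux (hpm a₀) (hpm _) (hpm _) (hpm _) (hC a₀ j) (hC _ i) (hC a₀ i) (hcyc j) hj hi
  have hedisj : ∀ i j, i ≠ j → ∀ e ∈ C i, e ∉ C j := by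
    intro i j hij e hi hj
    induction e using Sym2.ind with
    | _ x y => exact hdisj i j hij x ⟨_, hi, Sym2.mem_mk_left _ _⟩ ⟨_, hj, Sym2.mem_mk_left _ _⟩
  have hflip : ∀ a j e, e ∉ C j → (e ∈ f (flp a j) ↔ e ∈ f a) := by
    intro a j e he
    rw [← hC a j, Set.mem_symmDiff] at he
    tauto
  let M₀ : Set (Sym2 V) := f a₀ \ ⋃₀ Set.range C
  have hM₀ : ∀ a, f a \ ⋃₀ Set.range C = M₀ := by
    intro a
    refine flp_const (fun a => f a \ ⋃₀ Set.range C) ?_ a a₀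
    intro a i
    ext e
    simp only [Set.mem_diff]
    refine and_congr_left fun he => hflip a i e fun h => he ⟨_, ⟨i, rfl⟩, h⟩
  have hedge : ∀ a j v, coveredBy (C j) v → ∀ e ∈ f a, v ∈ e → e ∈ C j := fun a j v hv e he hve =>
    edge_mem (hpm a) (hpm _) (hC a j) hv he hve
  refine ⟨M₀ ∪ ⋃₀ Set.range C, Set.range C, M₀, ⟨?_, ?_, rfl, ?_, ?_, ?_, ?_⟩, ?_, ?_⟩
  · rintro _ ⟨j, rfl⟩
    exact hCF j
  · exact fun e he => (hpm a₀).1 he.1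
  · intro v e he e' he'
    exact pm_unique (hpm a₀) he.1.1 he.2 he'.1.1 he'.2
  · rintro _ ⟨i, rfl⟩ _ ⟨j, rfl⟩ hne v ⟨h1, h2⟩
    exact hdisj i j (fun h => hne (by rw [h])) v h1 h2
  · rintro _ ⟨j, rfl⟩ v hv ⟨e, he, hve⟩
    exact he.2 ⟨_, ⟨j, rfl⟩, hedge a₀ j v hv e he.1 hve⟩
  · intro v
    obtain ⟨e, ⟨he, hve⟩, _⟩ := (hpm a₀).2 v
    refine ⟨e, ?_, hve⟩
    by_cases h : e ∈ ⋃₀ Set.range C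
    · exact Or.inr h
    · exact Or.inl ⟨he, h⟩
  · rw [← Set.image_univ, Set.ncard_image_of_injective _ hCinj]
    simp
  · ext M
    rw [hXf, Set.mem_setOf_eq]
    constructor
    · rintro ⟨a, ha⟩
      rw [← ha]
      refine ⟨fun e he => ?_, ?_⟩
      · rw [← hM₀ a] at he
        exact he.1
      · rintro _ ⟨j, rfl⟩ v hv
        obtain ⟨e, ⟨he, hve⟩, huniq⟩ := (hpm a).2 v
        exact ⟨e, ⟨⟨he, hedge a j v hv e he hve⟩, hve⟩, fun e' h => huniq e' ⟨h.1.1, h.2⟩⟩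
    · rintro ⟨hsub, hcomp⟩
      have hex : ∀ s : Finset (Fin k), ∃ a, ∀ j ∈ s, ∀ e ∈ C j, e ∈ M.1 ↔ e ∈ f a := by
        classical
        intro s
        induction s using Finset.induction with
        | empty => exact ⟨a₀, by simp⟩
        | insert i s hi ih =>
          obtain ⟨a, ha⟩ := ih
          rcases agree (hpm a) (hpm _) M.2 (hC a i) (hcyc i) (hcomp _ ⟨i, rfl⟩) with h | h
          · refine ⟨a, fun j hj => ?_⟩
            rcases Finset.mem_insert.1 hj with rfl | hj
            · exact h
            · exact ha j hj
          · refine ⟨flp a i, fun j hj => ?_⟩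
            rcases Finset.mem_insert.1 hj with rfl | hj
            · exact h
            · intro e he
              have hji : j ≠ i := fun h => hi (h ▸ hj)
              rw [hflip a i e (hedisj j i hji e he)]
              exact ha j hj e he
      obtain ⟨a, ha⟩ := hex Finset.univ
      refine ⟨a, ?_⟩
      ext e
      by_cases heC : e ∈ ⋃₀ Set.range C
      · obtain ⟨_, ⟨j, rfl⟩, hj⟩ := heC
        exact (ha j (Finset.mem_univ _) e hj).symm
      · constructor
        · intro he
          apply hsub
          rw [← hM₀ a]
          exact ⟨he, heC⟩
        · intro he
          induction e using Sym2.ind with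
          | _ x y =>
            have hx : x ∈ s(x, y) := Sym2.mem_mk_left _ _
            obtain ⟨d, ⟨hd, hxd⟩, _⟩ := (hpm a).2 x
            have hdM : d ∈ M.1 := by
              by_cases hdC : d ∈ ⋃₀ Set.range C
              · obtain ⟨_, ⟨j, rfl⟩, hj⟩ := hdC
                exact (ha j (Finset.mem_univ _) d hj).2 hd
              · apply hsub
                rw [← hM₀ a]
                exact ⟨hd, hdC⟩
            exact pm_unique M.2 he hx hdM hxd ▸ hd
end

section
/- If S and S′ are two distinct Clar covers of G with respect to F (distinct as edge sets), then X(S) ≠ X(S′); that is, the map sending a Clar cover S to its set X(S) of compatible perfect matchings is injective. -/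
open SimpleGraph

variable {V : Type*}

theorem aux_seq (C : Set (Sym2 V)) (f : ℕ → V) (n : ℕ) (hn : Even n)
    (hinj : ∀ i j, i < n → j < n → f i = f j → i = j) (hf : f n = f 0)
    (hC : ∀ e, e ∈ C ↔ ∃ i < n, e = s(f i, f (i + 1))) :
    ∃ A B : Set (Sym2 V), A ⊆ C ∧ B ⊆ C ∧ C ⊆ A ∪ B ∧
      (∀ v, coveredBy C v → ∃! e, e ∈ A ∧ v ∈ e) ∧
      (∀ v, coveredBy C v → ∃! e, e ∈ B ∧ v ∈ e) := by
  obtain ⟨m, hm⟩ := hn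
  have hcov : ∀ v, coveredBy C v → ∃ k < n, v = f k := by
    rintro v ⟨e, he, hv⟩
    obtain ⟨i, hi, rfl⟩ := (hC e).1 he
    rcases Sym2.mem_iff.1 hv with rfl | rfl
    · exact ⟨i, hi, rfl⟩
    · by_cases h : i + 1 < n
      · exact ⟨i + 1, h, rfl⟩
      · have : i + 1 = n := by omega
        exact ⟨0, by omega, by rw [this, hf]⟩
  refine ⟨{e | ∃ i < n, i % 2 = 0 ∧ e = s(f i, f (i + 1))},
    {e | ∃ i < n, i % 2 = 1 ∧ e = s(f i, f (i + 1))}, ?_, ?_, ?_, ?_, ?_⟩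
  · rintro e ⟨i, hi, -, rfl⟩
    exact (hC _).2 ⟨i, hi, rfl⟩
  · rintro e ⟨i, hi, -, rfl⟩
    exact (hC _).2 ⟨i, hi, rfl⟩
  · intro e he
    obtain ⟨i, hi, rfl⟩ := (hC e).1 he
    rcases Nat.mod_two_eq_zero_or_one i with h | h
    · exact Or.inl ⟨i, hi, h, rfl⟩
    · exact Or.inr ⟨i, hi, h, rfl⟩
  · intro v hv
    obtain ⟨k, hk, rfl⟩ := hcov v hv
    have key : ∀ i < n, i % 2 = 0 → f k ∈ s(f i, f (i + 1)) → i = k - k % 2 := by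
      intro i hi h2 hmem
      rcases Sym2.mem_iff.1 hmem with h | h
      · have := hinj _ _ hk hi h; omega
      · have := hinj _ _ hk (by omega) h; omega
    refine ⟨s(f (k - k % 2), f (k - k % 2 + 1)),
      ⟨⟨k - k % 2, by omega, by omega, rfl⟩, ?_⟩, ?_⟩
    · rw [Sym2.mem_iff]
      rcases Nat.mod_two_eq_zero_or_one k with h | h
      · left; rw [h]; rfl
      · right; congr 1; omega
    · rintro e ⟨⟨i, hi, h2, rfl⟩, hmem⟩
      rw [key i hi h2 hmem]
  · intro v hv
    obtain ⟨k, hk, rfl⟩ := hcov v hv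
    have key : ∀ i < n, i % 2 = 1 → f k ∈ s(f i, f (i + 1)) →
        i = if k % 2 = 1 then k else if k = 0 then n - 1 else k - 1 := by
      intro i hi h2 hmem
      rcases Sym2.mem_iff.1 hmem with h | h
      · have := hinj _ _ hk hi h
        subst this
        simp [h2]
      · by_cases h3 : i + 1 < n
        · have := hinj _ _ hk h3 h
          subst this
          rw [if_neg (by omega), if_neg (by omega)]; omega
        · have h4 : i + 1 = n := by omega
          rw [h4, hf] at h
          have := hinj _ _ hk (by omega) h
          subst this
          simp; omega
    obtain ⟨j, hj⟩ : ∃ j, j = if k % 2 = 1 then k else if k = 0 then n - 1 else k - 1 := ⟨_, rfl⟩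
    rw [← hj] at key
    refine ⟨s(f j, f (j + 1)), ⟨⟨j, ?_, ?_, rfl⟩, ?_⟩, ?_⟩
    · split_ifs at hj <;> omega
    · split_ifs at hj <;> omega
    · rw [Sym2.mem_iff]
      split_ifs at hj with h1 h2
      · left; rw [hj]
      · right
        have : j + 1 = n := by omega
        rw [this, hf, h2]
      · right; congr 1; omega
    · rintro e ⟨⟨i, hi, h2, rfl⟩, hmem⟩
      rw [key i hi h2 hmem]

theorem aux_cycle [Fintype V] (G : SimpleGraph V) (C : Set (Sym2 V)) (h : IsEvenCycleSet G C) :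
    ∃ A B : Set (Sym2 V), A ⊆ C ∧ B ⊆ C ∧ C ⊆ A ∪ B ∧
      (∀ v, coveredBy C v → ∃! e, e ∈ A ∧ v ∈ e) ∧
      (∀ v, coveredBy C v → ∃! e, e ∈ B ∧ v ∈ e) := by
  classical
  obtain ⟨⟨hsub, ⟨e₀, he₀⟩, hreg, hconn⟩, heven⟩ := h
  have hcyc : (fromEdgeSet C).IsCycles := fun v ⟨w, hw⟩ => hreg v ⟨w, hw⟩
  have hadj : ∀ a b, s(a, b) ∈ C ↔ (fromEdgeSet C).Adj a b := by
    intro a b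
    rw [fromEdgeSet_adj]
    exact ⟨fun h => ⟨h, (G.mem_edgeSet.1 (hsub h)).ne⟩, fun h => h.1⟩
  induction e₀ with | _ a b
  have hab := (hadj a b).1 he₀
  obtain ⟨p, hp, hpv⟩ := hcyc.exists_cycle_toSubgraph_verts_eq_connectedComponentSupp
    (c := (fromEdgeSet C).connectedComponentMk a) (v := a) rfl ⟨b, hab⟩
  have hedge : ∀ x y, s(x, y) ∈ C ↔ p.toSubgraph.Adj x y := by
    intro x y
    refine ⟨fun h => ?_, fun h => (hadj x y).2 h.adj_sub⟩
    have hxy := (hadj x y).1 h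
    have hx : x ∈ p.toSubgraph.verts := by
      rw [hpv]
      exact ConnectedComponent.sound (hconn x ⟨y, hxy⟩ a ⟨b, hab⟩)
    exact (hp.adj_toSubgraph_iff_of_isCycles hcyc hx y).2 hxy
  have hCe : C = (p.edges.toFinset : Set (Sym2 V)) := by
    ext e
    induction e with | _ x y
    rw [hedge, ← Subgraph.mem_edgeSet, Walk.mem_edges_toSubgraph]
    simp
  have hlen : C.ncard = p.length := by
    refine (congrArg Set.ncard hCe).trans ?_
    rw [Set.ncard_coe_finset, List.toFinset_card_of_nodup hp.edges_nodup, Walk.length_edges]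
  rw [hlen] at heven
  refine aux_seq C p.getVert p.length heven ?_ (by simp) ?_
  · intro i j hi hj hij
    exact hp.getVert_injOn' (by simp only [Set.mem_ofPred_eq]; omega)
      (by simp only [Set.mem_ofPred_eq]; omega) hij
  · intro e
    induction e with | _ x y
    rw [hedge, Walk.toSubgraph_adj_iff]
    constructor
    · rintro ⟨i, h1, h2⟩
      exact ⟨i, h2, h1.symm⟩
    · rintro ⟨i, h1, h2⟩
      exact ⟨i, h2.symm, h1⟩

theorem aux_pm (G : SimpleGraph V) (F : Set (Set (Sym2 V)))
    (hFcyc : ∀ C ∈ F, IsEvenCycleSet G C)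
    (S : Set (Sym2 V)) (𝒞 : Set (Set (Sym2 V))) (M₀ : Set (Sym2 V))
    (hS : IsClarDecomp G F S 𝒞 M₀) (A : Set (Sym2 V) → Set (Sym2 V))
    (hA : ∀ C ∈ 𝒞, A C ⊆ C)
    (hA' : ∀ C ∈ 𝒞, ∀ v, coveredBy C v → ∃! e, e ∈ A C ∧ v ∈ e) :
    IsPM G {e | e ∈ M₀ ∨ ∃ C ∈ 𝒞, e ∈ A C} ∧
      ClarCompatible 𝒞 M₀ {e | e ∈ M₀ ∨ ∃ C ∈ 𝒞, e ∈ A C} := by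
  obtain ⟨hF, hM, rfl, hmat, hdis, hdis', hcov⟩ := hS
  have key : ∀ C ∈ 𝒞, ∀ v, coveredBy C v → ∀ e,
      (e ∈ M₀ ∨ ∃ C ∈ 𝒞, e ∈ A C) → v ∈ e → e ∈ A C := by
    rintro C hC v hv e (he | ⟨D, hD, he⟩) hve
    · exact absurd ⟨e, he, hve⟩ (hdis' C hC v hv)
    · by_cases hCD : C = D
      · rwa [hCD]
      · exact absurd ⟨hv, e, hA D hD he, hve⟩ (hdis C hC D hD hCD v)
  refine ⟨⟨?_, ?_⟩, ?_, ?_⟩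
  · rintro e (he | ⟨C, hC, he⟩)
    · exact hM he
    · exact (hFcyc C (hF hC)).1.1 (hA C hC he)
  · intro v
    obtain ⟨e, he | ⟨C, hC, he⟩, hve⟩ := hcov v
    · refine ⟨e, ⟨Or.inl he, hve⟩, ?_⟩
      rintro e' ⟨he' | ⟨C, hC, he'⟩, hve'⟩
      · exact hmat v ⟨he', hve'⟩ ⟨he, hve⟩
      · exact absurd ⟨e, he, hve⟩ (hdis' C hC v ⟨e', hA C hC he', hve'⟩)
    · have hv : coveredBy C v := ⟨e, he, hve⟩
      obtain ⟨e₁, ⟨h1, h2⟩, hu⟩ := hA' C hC v hv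
      refine ⟨e₁, ⟨Or.inr ⟨C, hC, h1⟩, h2⟩, ?_⟩
      rintro e' ⟨he', hve'⟩
      exact hu e' ⟨key C hC v hv e' he' hve', hve'⟩
  · exact fun e he => Or.inl he
  · intro C hC v hv
    obtain ⟨e₁, ⟨h1, h2⟩, hu⟩ := hA' C hC v hv
    refine ⟨e₁, ⟨⟨Or.inr ⟨C, hC, h1⟩, hA C hC h1⟩, h2⟩, ?_⟩
    rintro e' ⟨⟨he', -⟩, hve'⟩
    exact hu e' ⟨key C hC v hv e' he' hve', hve'⟩

theorem aux_union [Fintype V] (G : SimpleGraph V) (F : Set (Set (Sym2 V)))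
    (hFcyc : ∀ C ∈ F, IsEvenCycleSet G C)
    (S : Set (Sym2 V)) (𝒞 : Set (Set (Sym2 V))) (M₀ : Set (Sym2 V))
    (hS : IsClarDecomp G F S 𝒞 M₀) (e : Sym2 V) :
    e ∈ S ↔ ∃ M : {M : Set (Sym2 V) // IsPM G M}, ClarCompatible 𝒞 M₀ M.1 ∧ e ∈ M.1 := by
  classical
  constructor
  · intro he
    have hF := hS.1
    have hex : ∀ C, ∃ A B : Set (Sym2 V), C ∈ 𝒞 → (A ⊆ C ∧ B ⊆ C ∧ C ⊆ A ∪ B ∧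
      (∀ v, coveredBy C v → ∃! e, e ∈ A ∧ v ∈ e) ∧
      (∀ v, coveredBy C v → ∃! e, e ∈ B ∧ v ∈ e)) := by
      intro C
      by_cases hC : C ∈ 𝒞
      · obtain ⟨A, B, h⟩ := aux_cycle G C (hFcyc C (hF hC))
        exact ⟨A, B, fun _ => h⟩
      · exact ⟨∅, ∅, fun h => absurd h hC⟩
    choose A B hAB using hex
    have h1 := aux_pm G F hFcyc S 𝒞 M₀ hS A (fun C hC => (hAB C hC).1)
      (fun C hC => (hAB C hC).2.2.2.1)
    have h2 := aux_pm G F hFcyc S 𝒞 M₀ hS B (fun C hC => (hAB C hC).2.1)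
      (fun C hC => (hAB C hC).2.2.2.2)
    rw [hS.2.2.1] at he
    rcases he with he | ⟨C, hC, he⟩
    · exact ⟨⟨_, h1.1⟩, h1.2, Or.inl he⟩
    · rcases (hAB C hC).2.2.1 he with he | he
      · exact ⟨⟨_, h1.1⟩, h1.2, Or.inr ⟨C, hC, he⟩⟩
      · exact ⟨⟨_, h2.1⟩, h2.2, Or.inr ⟨C, hC, he⟩⟩
  · rintro ⟨⟨M, hM⟩, ⟨hc1, hc2⟩, he⟩
    obtain ⟨-, -, rfl, -, -, -, hcov⟩ := hS
    obtain ⟨v, hv⟩ : ∃ v, v ∈ e := by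
      induction e with | _ x y
      exact ⟨x, Sym2.mem_mk_left x y⟩
    obtain ⟨e', he' | ⟨C, hC, he'⟩, hve'⟩ := hcov v
    · have := (hM.2 v).unique ⟨he, hv⟩ ⟨hc1 he', hve'⟩
      exact Or.inl (this ▸ he')
    · obtain ⟨e₁, ⟨⟨h1, h2⟩, h3⟩, -⟩ := hc2 C hC v ⟨e', he', hve'⟩
      have := (hM.2 v).unique ⟨he, hv⟩ ⟨h1, h3⟩
      exact Or.inr ⟨C, hC, this ▸ h2⟩

/-- If `S` and `S'` are two distinct Clar covers of `G` with respect
to `F` (distinct as edge sets), then `X(S) ≠ X(S')`: the map sending a Clar cover to its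
set of compatible perfect matchings is injective. -/
theorem statement10 [Fintype V] (G : SimpleGraph V)
    (F : Set (Set (Sym2 V))) (hFfin : F.Finite)
    (hFcyc : ∀ C ∈ F, IsEvenCycleSet G C)
    (S S' : Set (Sym2 V)) (𝒞 𝒞' : Set (Set (Sym2 V))) (M₀ M₀' : Set (Sym2 V))
    (hS : IsClarDecomp G F S 𝒞 M₀) (hS' : IsClarDecomp G F S' 𝒞' M₀')
    (hne : S ≠ S') :
    {M : {M : Set (Sym2 V) // IsPM G M} | ClarCompatible 𝒞 M₀ M.1} ≠
      {M : {M : Set (Sym2 V) // IsPM G M} | ClarCompatible 𝒞' M₀' M.1} := by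
  intro heq
  apply hne
  ext e
  rw [aux_union G F hFcyc S 𝒞 M₀ hS, aux_union G F hFcyc S' 𝒞' M₀' hS']
  have h : ∀ M : {M : Set (Sym2 V) // IsPM G M},
      ClarCompatible 𝒞 M₀ M.1 ↔ ClarCompatible 𝒞' M₀' M.1 := fun M => Set.ext_iff.1 heq M
  simp only [h]
end

section
/- Let H be a connected component of the resonance graph R(G;F), let J = {i ∈ F : M₁ Δ M₂ = E(i) for some pair of adjacent vertices M₁, M₂ of H}, and let G_H be the subgraph of G whose edge set is the union of the sets E(i) over i ∈ J and whose vertex set is the set of endpoints of these edges. Then for every perfect matching M that is a vertex of H, the set M ∩ E(G_H) is a perfect matching of G_H. -/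
open SimpleGraph

variable {V : Type*} {I : Type*}

/-- Let `H` be a connected component of `R(G;F)`, let `J` be the set
of indices `i ∈ F` with `M₁ Δ M₂ = E i` for some pair of adjacent vertices of `H`, and
let `G_H` be the subgraph of `G` with edge set `EH = ⋃ i ∈ J, E i` (its vertices being
the endpoints of these edges).  Then for every perfect matching `M` that is a vertex of
`H`, the set `M ∩ EH` is a perfect matching of `G_H`: every vertex of `G_H` is incident
with exactly one edge of `M ∩ EH`. -/
theorem statement12 [Fintype V] [Fintype I] (G : SimpleGraph V)
    (E : I → Set (Sym2 V)) (F : Set I)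
    (hFcyc : ∀ i ∈ F, IsEvenCycleSet G (E i))
    (H : (resGraph G E F).ConnectedComponent)
    (J : Set I)
    (hJ : J = {i ∈ F | ∃ M₁ M₂ : {M : Set (Sym2 V) // IsPM G M},
        (resGraph G E F).connectedComponentMk M₁ = H ∧
        (resGraph G E F).connectedComponentMk M₂ = H ∧
        (resGraph G E F).Adj M₁ M₂ ∧ symmDiff M₁.1 M₂.1 = E i})
    (EH : Set (Sym2 V)) (hEH : EH = ⋃ i ∈ J, E i)
    (M : {M : Set (Sym2 V) // IsPM G M})
    (hM : (resGraph G E F).connectedComponentMk M = H) :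
    ∀ v : V, coveredBy EH v → ∃! e, e ∈ M.1 ∩ EH ∧ v ∈ e := by
  have key : ∀ N : {M : Set (Sym2 V) // IsPM G M},
      (resGraph G E F).Reachable M N → ∀ f, f ∈ M.1 → f ∉ N.1 → f ∈ EH := by
    intro N hN
    obtain ⟨p⟩ := hN
    induction p with
    | nil => intro f h1 h2; exact absurd h1 h2
    | @cons a b c hab p ih =>
      intro f h1 h2
      have hb : (resGraph G E F).connectedComponentMk b = H := by
        rw [← hM]
        exact (SimpleGraph.ConnectedComponent.sound hab.reachable).symm
      by_cases hf : f ∈ b.1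
      · exact ih hb f hf h2
      · have hex : ∃ i ∈ F, symmDiff a.1 b.1 = E i := by
          have hab' := hab
          unfold resGraph at hab'
          rw [SimpleGraph.fromRel_adj] at hab'
          rcases hab'.2 with h | ⟨i, hi, h⟩
          · exact h
          · exact ⟨i, hi, by rw [symmDiff_comm]; exact h⟩
        obtain ⟨i, hi, hE⟩ := hex
        rw [hEH]
        refine Set.mem_biUnion (x := i) ?_ ?_
        · rw [hJ]
          exact ⟨hi, a, b, hM, hb, hab, hE⟩
        · rw [← hE]
          exact Or.inl ⟨h1, hf⟩
  rintro v ⟨e, he, hve⟩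
  have hN : ∃ N : {M : Set (Sym2 V) // IsPM G M},
      (resGraph G E F).connectedComponentMk N = H ∧ e ∈ N.1 := by
    have he' := he
    rw [hEH, Set.mem_iUnion₂] at he'
    obtain ⟨i, hi, hei⟩ := he'
    rw [hJ] at hi
    obtain ⟨-, M₁, M₂, h1, h2, -, hs⟩ := hi
    rw [← hs] at hei
    rcases hei with h | h
    · exact ⟨M₁, h1, h.1⟩
    · exact ⟨M₂, h2, h.1⟩
  obtain ⟨N, hNH, heN⟩ := hN
  obtain ⟨f, ⟨hfM, hvf⟩, huniq⟩ := M.2.2 v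
  refine ⟨f, ⟨⟨hfM, ?_⟩, hvf⟩, fun g hg => huniq g ⟨hg.1.1, hg.2⟩⟩
  by_cases hfN : f ∈ N.1
  · rw [(N.2.2 v).unique ⟨hfN, hvf⟩ ⟨heN, hve⟩]
    exact he
  · exact key N (SimpleGraph.ConnectedComponent.exact (hM.trans hNH.symm)) f hfM hfN
end
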